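/- arXiv:2005.08169 — 2 statements merged into one kernel-verified Lean document; each statement's English description precedes it below -/
import Mathlib

section
/- Let G be a bipartite outerplanar graph of order n with bipartition (X, Y) where |Y| ≥ |X| ≥ 1. Then the number of edges of G satisfies e(G) ≤ n + |X| - 2. -/
open SimpleGraph

/-- `H` is a minor of `G`: disjoint nonempty connected branch sets, one per vertex of `H`,
with an edge of `G` between branch sets corresponding to each edge of `H`. -/
def HasMinor {V W : Type*} (G : SimpleGraph V) (H : SimpleGraph W) : Prop :=
  ∃ f : W → Set V,
    (∀ w, (f w).Nonempty) ∧
    (∀ w, (G.induce (f w)).Connected) ∧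
    (Pairwise fun w₁ w₂ => Disjoint (f w₁) (f w₂)) ∧
    ∀ ⦃w₁ w₂⦄, H.Adj w₁ w₂ → ∃ v₁ ∈ f w₁, ∃ v₂ ∈ f w₂, G.Adj v₁ v₂

/-- A graph is outerplanar iff it has no `K₄`-minor and no `K_{2,3}`-minor. -/
def Outerplanar {V : Type*} (G : SimpleGraph V) : Prop :=
  ¬ HasMinor G (completeGraph (Fin 4)) ∧
  ¬ HasMinor G (completeBipartiteGraph (Fin 2) (Fin 3))

/-- A maximal outerplanar graph: outerplanar and no edge can be added keeping outerplanarity. -/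
def MaximalOuterplanar {V : Type*} (G : SimpleGraph V) : Prop :=
  Outerplanar G ∧ ∀ u v : V, u ≠ v → ¬ G.Adj u v →
    ¬ Outerplanar (G ⊔ fromEdgeSet {s(u, v)})

/-- `M` is a matching (a set of pairwise disjoint edges) of the graph `G`. -/
def IsMatchingSet {V : Type*} (G : SimpleGraph V) (M : Finset (Sym2 V)) : Prop :=
  (∀ e ∈ M, e ∈ G.edgeSet) ∧
  ∀ e ∈ M, ∀ f ∈ M, e ≠ f → ∀ v : V, v ∈ e → v ∉ f

/-- `M` is a rainbow matching of size `k` in `G` under edge-coloring `c`. -/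
def IsRainbowMatching {V : Type*} (G : SimpleGraph V) (c : Sym2 V → ℕ) (k : ℕ)
    (M : Finset (Sym2 V)) : Prop :=
  IsMatchingSet G M ∧ M.card = k ∧ Set.InjOn c ↑M

/-- The sets `B i`, for `i ∈ I`, are pairwise disjoint and induce connected subgraphs of `G`. -/
structure IsBranchFamily {V ι : Type*} (G : SimpleGraph V) (B : ι → Set V) (I : Finset ι) :
    Prop where
  connected : ∀ i ∈ I, (G.induce (B i)).Connected
  disjoint : ∀ i ∈ I, ∀ j ∈ I, i ≠ j → Disjoint (B i) (B j)

open Classical in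
/-- The indices `i ∈ I` for which the vertex `y` has a neighbour in `B i`. -/
noncomputable def incident {V ι : Type*} (G : SimpleGraph V) (B : ι → Set V) (I : Finset ι)
    (y : V) : Finset ι :=
  I.filter fun i => ∃ v ∈ B i, G.Adj v y

theorem mem_incident {V ι : Type*} {G : SimpleGraph V} {B : ι → Set V} {I : Finset ι} {y : V}
    {i : ι} : i ∈ incident G B I y ↔ i ∈ I ∧ ∃ v ∈ B i, G.Adj v y := by
  simp [incident]

theorem incident_subset {V ι : Type*} (G : SimpleGraph V) (B : ι → Set V) (I : Finset ι) (y : V) :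
    incident G B I y ⊆ I :=
  fun _ hi => (mem_incident.1 hi).1

theorem IsBranchFamily.mono {V ι : Type*} {G : SimpleGraph V} {B : ι → Set V} {I J : Finset ι}
    (h : IsBranchFamily G B I) (hJ : J ⊆ I) : IsBranchFamily G B J :=
  ⟨fun i hi => h.connected i (hJ hi), fun i hi j hj => h.disjoint i (hJ hi) j (hJ hj)⟩

/-- Two disjoint connected sets with three common neighbours outside form a `K_{2,3}`-minor. -/
theorem IsBranchFamily.hasMinor_completeBipartiteGraph {V ι : Type*} {G : SimpleGraph V}
    {B : ι → Set V} {I : Finset ι} (h : IsBranchFamily G B I) {i j : ι} (hij : i ≠ j) {y : Fin 3 → V}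
    (hy : Function.Injective y) (hout : ∀ k, ∀ i ∈ I, y k ∉ B i)
    (hi : ∀ k, i ∈ incident G B I (y k)) (hj : ∀ k, j ∈ incident G B I (y k)) :
    HasMinor G (completeBipartiteGraph (Fin 2) (Fin 3)) := by
  have hi' := fun k => mem_incident.1 (hi k)
  have hj' := fun k => mem_incident.1 (hj k)
  have hiI := (hi' 0).1
  have hjI := (hj' 0).1
  have hconn : ∀ w, (G.induce (Sum.elim ![B i, B j] (fun k => {y k}) w)).Connected := by
    rintro (a | k)
    · fin_cases a
      · exact h.connected i hiI
      · exact h.connected j hjI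
    · change (G.induce {y k}).Connected
      rw [induce_singleton_eq_top]
      exact connected_top
  have hadj : ∀ (a : Fin 2) (k : Fin 3), ∃ v ∈ (![B i, B j] : Fin 2 → Set V) a, G.Adj v (y k) := by
    intro a k
    fin_cases a
    · exact (hi' k).2
    · exact (hj' k).2
  have hdisj : ∀ (a : Fin 2) (k : Fin 3), y k ∉ (![B i, B j] : Fin 2 → Set V) a := by
    intro a k
    fin_cases a
    · exact hout k i hiI
    · exact hout k j hjI
  refine ⟨Sum.elim ![B i, B j] (fun k => {y k}), ?_, hconn, ?_, ?_⟩
  · intro w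
    obtain ⟨v⟩ := (hconn w).nonempty
    exact ⟨v, v.2⟩
  · rintro (a | k) (b | l) hne
    · have hd := h.disjoint i hiI j hjI hij
      fin_cases a <;> fin_cases b
      · exact absurd rfl hne
      · exact hd
      · exact hd.symm
      · exact absurd rfl hne
    · exact Set.disjoint_singleton_right.2 (hdisj a l)
    · exact Set.disjoint_singleton_left.2 (hdisj b k)
    · exact Set.disjoint_singleton.2 fun e => hne (congrArg Sum.inr (hy e))
  · rintro (a | k) (b | l) hw
    · simp at hw
    · obtain ⟨v, hv, hvy⟩ := hadj a l
      exact ⟨v, hv, y l, rfl, hvy⟩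
    · obtain ⟨v, hv, hvy⟩ := hadj b k
      exact ⟨y k, rfl, v, hv, hvy.symm⟩
    · simp at hw

/-- The union of `{y}` with connected sets each containing a neighbour of `y` is connected. -/
theorem connected_induce_insert_biUnion {V ι : Type*} {G : SimpleGraph V} {B : ι → Set V}
    {N : Finset ι} {y : V} (hc : ∀ i ∈ N, (G.induce (B i)).Connected)
    (hN : ∀ i ∈ N, ∃ v ∈ B i, G.Adj v y) :
    (G.induce (insert y (⋃ i ∈ N, B i))).Connected := by
  have hy : (G.induce {y}).Connected := by
    rw [induce_singleton_eq_top]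
    exact connected_top
  apply G.induce_connected_of_patches y (Set.mem_insert _ _)
  rintro w (rfl | hw)
  · exact ⟨{w}, by simp, rfl, rfl, Reachable.refl _⟩
  · obtain ⟨i, hi, hwi⟩ := Set.mem_iUnion₂.1 hw
    obtain ⟨v, hv, hvy⟩ := hN i hi
    have hpair : (G.induce {v, y}).Connected := induce_pair_connected_of_adj hvy
    have hu := induce_union_connected (hc i hi).preconnected hpair.preconnected ⟨v, hv, by simp⟩
    refine ⟨B i ∪ {v, y}, ?_, Or.inr (by simp), Or.inl hwi, hu.preconnected _ _⟩
    have hsub : B i ⊆ ⋃ i ∈ N, B i := Set.subset_biUnion_of_mem (u := B) hi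
    rintro x (hx | rfl | rfl)
    · exact Or.inr (hsub hx)
    · exact Or.inr (hsub hv)
    · exact Or.inl rfl

/-- Contracting an outside vertex `y` with all the branch sets it is adjacent to. -/
theorem IsBranchFamily.exists_merge {V ι : Type*} {G : SimpleGraph V} {B : ι → Set V}
    {I : Finset ι} (h : IsBranchFamily G B I) {y : V} (hy : ∀ i ∈ I, y ∉ B i)
    (hN : (incident G B I y).Nonempty) :
    ∃ (B' : ι → Set V) (I' : Finset ι), I' ⊆ I ∧ I'.Nonempty ∧ (∀ i, B i ⊆ B' i) ∧
      IsBranchFamily G B' I' ∧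
      (∀ z ≠ y, (∀ i ∈ I, z ∉ B i) → ∀ i ∈ I', z ∉ B' i) ∧
      I'.card + (incident G B I y).card = I.card + 1 ∧
      ∀ z, (incident G B I z).card ≤
        (incident G B' I' z).card + ((incident G B (incident G B I y) z).card - 1) := by
  classical
  set N := incident G B I y with hNdef
  have hNI : N ⊆ I := incident_subset G B I y
  obtain ⟨i₀, hi₀⟩ := hN
  set S : Set V := insert y (⋃ i ∈ N, B i) with hS
  have hBS : ∀ i ∈ N, B i ⊆ S := fun i hi =>
    (Set.subset_biUnion_of_mem (u := B) hi).trans (Set.subset_insert _ _)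
  have hsdiff : i₀ ∉ I \ N := by simp [hi₀]
  have hne : ∀ i ∈ I \ N, i ≠ i₀ := fun i hi e => hsdiff (e ▸ hi)
  have hdisj : ∀ i ∈ I \ N, Disjoint (B i) S := by
    intro i hi
    obtain ⟨hiI, hiN⟩ := Finset.mem_sdiff.1 hi
    rw [hS, Set.disjoint_insert_right, Set.disjoint_iUnion₂_right]
    exact ⟨hy i hiI, fun j hj => h.disjoint i hiI j (hNI hj) fun e => hiN (e ▸ hj)⟩
  have hmono : ∀ i, B i ⊆ Function.update B i₀ S i := by
    intro i
    rcases eq_or_ne i i₀ with rfl | hi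
    · simpa using hBS i hi₀
    · simp [hi]
  refine ⟨Function.update B i₀ S, insert i₀ (I \ N), ?_, Finset.insert_nonempty _ _, hmono,
    ⟨?_, ?_⟩, ?_, ?_, ?_⟩
  · exact Finset.insert_subset (hNI hi₀) Finset.sdiff_subset
  · intro i hi
    rcases Finset.mem_insert.1 hi with rfl | hi
    · rw [Function.update_self]
      exact connected_induce_insert_biUnion (fun j hj => h.connected j (hNI hj))
        fun j hj => (mem_incident.1 hj).2
    · rw [Function.update_of_ne (hne i hi)]
      exact h.connected i (Finset.mem_sdiff.1 hi).1
  · intro i hi' j hj' hij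
    rcases Finset.mem_insert.1 hi' with rfl | hi <;> rcases Finset.mem_insert.1 hj' with rfl | hj
    · exact absurd rfl hij
    · rw [Function.update_self, Function.update_of_ne (hne j hj)]
      exact (hdisj j hj).symm
    · rw [Function.update_self, Function.update_of_ne (hne i hi)]
      exact hdisj i hi
    · rw [Function.update_of_ne (hne i hi), Function.update_of_ne (hne j hj)]
      exact h.disjoint i (Finset.mem_sdiff.1 hi).1 j (Finset.mem_sdiff.1 hj).1 hij
  · intro z hz hzB i hi
    rcases Finset.mem_insert.1 hi with rfl | hi
    · rw [Function.update_self, hS]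
      simp only [Set.mem_insert_iff, Set.mem_iUnion, not_or, not_exists]
      exact ⟨hz, fun j hj => hzB j (hNI hj)⟩
    · rw [Function.update_of_ne (hne i hi)]
      exact hzB i (Finset.mem_sdiff.1 hi).1
  · rw [Finset.card_insert_of_notMem hsdiff]
    have := Finset.card_sdiff_add_card_eq_card hNI
    omega
  · intro z
    have hsplit : incident G B I z ⊆ incident G B (I \ N) z ∪ incident G B N z := by
      intro i hi
      obtain ⟨hiI, hiz⟩ := mem_incident.1 hi
      by_cases hiN : i ∈ N
      · exact Finset.mem_union_right _ (mem_incident.2 ⟨hiN, hiz⟩)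
      · exact Finset.mem_union_left _ (mem_incident.2 ⟨Finset.mem_sdiff.2 ⟨hiI, hiN⟩, hiz⟩)
    have h1 := (Finset.card_le_card hsplit).trans (Finset.card_union_le _ _)
    have hsub : incident G B (I \ N) z ⊆
        incident G (Function.update B i₀ S) (insert i₀ (I \ N)) z := by
      intro i hi
      obtain ⟨hiI, v, hv, hvz⟩ := mem_incident.1 hi
      exact mem_incident.2 ⟨Finset.mem_insert_of_mem hiI, v, hmono i hv, hvz⟩
    rcases (incident G B N z).eq_empty_or_nonempty with he | ⟨j, hj⟩
    · have h2 := Finset.card_le_card hsub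
      rw [he] at h1 ⊢
      simp only [Finset.card_empty] at h1 ⊢
      omega
    · obtain ⟨hjN, v, hv, hvz⟩ := mem_incident.1 hj
      have hi₀z : i₀ ∈ incident G (Function.update B i₀ S) (insert i₀ (I \ N)) z := by
        refine mem_incident.2 ⟨Finset.mem_insert_self _ _, v, ?_, hvz⟩
        rw [Function.update_self]
        exact hBS j hjN hv
      have h2 := Finset.card_le_card (Finset.insert_subset hi₀z hsub)
      rw [Finset.card_insert_of_notMem fun hc => hsdiff (incident_subset _ _ _ _ hc)] at h2
      omega

/-- If `y` is adjacent to every branch set, then the incidence structure between the branch sets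
and the other outside vertices is acyclic, and so satisfies the counting bound for a forest. -/
theorem IsBranchFamily.sum_card_incident_sub_one_lt {V ι : Type*} {G : SimpleGraph V}
    (hG : ¬ HasMinor G (completeBipartiteGraph (Fin 2) (Fin 3))) {y : V} {Y : Finset V}
    (hyY : y ∉ Y) {B : ι → Set V} {I : Finset ι} (h : IsBranchFamily G B I) (hI : I.Nonempty)
    (hyB : ∀ i ∈ I, y ∉ B i) (hYB : ∀ z ∈ Y, ∀ i ∈ I, z ∉ B i)
    (hy : ∀ i ∈ I, ∃ v ∈ B i, G.Adj v y) :
    ∑ z ∈ Y, ((incident G B I z).card - 1) < I.card := by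
  classical
  induction Y using Finset.induction_on generalizing B I with
  | empty => simpa using hI.card_pos
  | insert x Y hxY ih =>
    simp only [Finset.mem_insert, not_or] at hyY
    rw [Finset.sum_insert hxY]
    rcases (incident G B I x).eq_empty_or_nonempty with he | hne
    · simpa [he] using ih hyY.2 h hI hyB (fun z hz => hYB z (Finset.mem_insert_of_mem hz)) hy
    · have hxB := hYB x (Finset.mem_insert_self x Y)
      obtain ⟨B', I', hI', hne', hB', h', hout, hcard, hle⟩ := h.exists_merge hxB hne
      have key := ih hyY.2 h' hne' (hout y hyY.1 hyB)
        (fun z hz => hout z (fun e => hxY (e ▸ hz)) (hYB z (Finset.mem_insert_of_mem hz)))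
        (fun i hi => (hy i (hI' hi)).imp fun v hv => ⟨hB' i hv.1, hv.2⟩)
      have hmono : ∑ z ∈ Y, ((incident G B I z).card - 1) ≤
          ∑ z ∈ Y, ((incident G B' I' z).card - 1) := by
        refine Finset.sum_le_sum fun z hz => ?_
        have hone : (incident G B (incident G B I x) z).card ≤ 1 := by
          rw [Finset.card_le_one]
          intro i hi j hj
          by_contra hij
          have hxz : x ≠ z := fun e => hxY (e ▸ hz)
          have hyz : y ≠ z := fun e => hyY.2 (e ▸ hz)
          have hall : ∀ i ∈ incident G B (incident G B I x) z,
              ∀ k, i ∈ incident G B I ((![y, x, z] : Fin 3 → V) k) := by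
            intro i hi k
            obtain ⟨hix, hiz⟩ := mem_incident.1 hi
            have hiI := incident_subset _ _ _ _ hix
            fin_cases k
            · exact mem_incident.2 ⟨hiI, hy i hiI⟩
            · exact hix
            · exact mem_incident.2 ⟨hiI, hiz⟩
          refine hG (h.hasMinor_completeBipartiteGraph hij (y := ![y, x, z]) ?_ ?_
            (hall i hi) (hall j hj))
          · intro k l hkl
            fin_cases k <;> fin_cases l <;> simp_all
          · intro k
            fin_cases k
            · exact hyB
            · exact hxB
            · exact hYB z (Finset.mem_insert_of_mem hz)
        have := hle z
        omega
      have := hne.card_pos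
      omega

/-- The number of incidences between the branch sets and the vertices of `Y` in a graph without
`K_{2,3}`-minor. -/
theorem IsBranchFamily.sum_card_incident_add_two_le {V ι : Type*} {G : SimpleGraph V}
    (hG : ¬ HasMinor G (completeBipartiteGraph (Fin 2) (Fin 3))) {Y : Finset V}
    {B : ι → Set V} {I : Finset ι} (h : IsBranchFamily G B I) (hI : I.Nonempty)
    (hYB : ∀ z ∈ Y, ∀ i ∈ I, z ∉ B i) :
    ∑ z ∈ Y, (incident G B I z).card + 2 ≤ 2 * I.card + Y.card := by
  classical
  induction Y using Finset.induction_on generalizing B I with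
  | empty =>
    have := hI.card_pos
    simp only [Finset.sum_empty, Finset.card_empty]
    omega
  | insert y Y hyY ih =>
    rw [Finset.sum_insert hyY, Finset.card_insert_of_notMem hyY]
    have hYB' := fun z hz => hYB z (Finset.mem_insert_of_mem hz)
    rcases (incident G B I y).eq_empty_or_nonempty with he | hne
    · have := ih h hI hYB'
      rw [he, Finset.card_empty]
      omega
    · have hyB := hYB y (Finset.mem_insert_self y Y)
      have hsub := incident_subset G B I y
      have hstar := (h.mono hsub).sum_card_incident_sub_one_lt hG hyY hne
        (fun i hi => hyB i (hsub hi)) (fun z hz i hi => hYB' z hz i (hsub hi))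
        (fun i hi => (mem_incident.1 hi).2)
      obtain ⟨B', I', -, hne', -, h', hout, hcard, hle⟩ := h.exists_merge hyB hne
      have key := ih h' hne' fun z hz => hout z (fun e => hyY (e ▸ hz)) (hYB' z hz)
      have hsum := Finset.sum_le_sum fun z (_ : z ∈ Y) => hle z
      rw [Finset.sum_add_distrib] at hsum
      omega

/-- A bipartite outerplanar graph with parts `X`, `Y`, `|Y| ≥ |X| ≥ 1`,
has at most `n + |X| - 2` edges. -/
theorem stmt0 {V : Type*} [Fintype V] (G : SimpleGraph V) (X Y : Finset V)
    (hpart : ∀ v : V, (v ∈ X ∧ v ∉ Y) ∨ (v ∈ Y ∧ v ∉ X))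
    (hbip : ∀ u v : V, G.Adj u v → (u ∈ X ∧ v ∈ Y) ∨ (u ∈ Y ∧ v ∈ X))
    (hX : 1 ≤ X.card) (hXY : X.card ≤ Y.card)
    (hop : Outerplanar G) :
    G.edgeSet.ncard ≤ Fintype.card V + X.card - 2 := by
  classical
  have hdisj : Disjoint X Y := Finset.disjoint_left.2 fun v hv hv' => by
    rcases hpart v with h | h
    · exact h.2 hv'
    · exact h.2 hv
  have hcard : X.card + Y.card = Fintype.card V := by
    rw [← Finset.card_union_of_disjoint hdisj, ← Finset.card_univ]
    congr 1
    ext v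
    rcases hpart v with h | h <;> simp [h.1]
  have hB : G.IsBipartiteWith (X : Set V) (Y : Set V) :=
    ⟨Finset.disjoint_coe.2 hdisj, fun u v huv => hbip u v huv⟩
  have hfam : IsBranchFamily G (fun v : V => ({v} : Set V)) X := by
    refine ⟨fun i _ => ?_, fun i _ j _ hij => Set.disjoint_singleton.2 hij⟩
    rw [induce_singleton_eq_top]
    exact connected_top
  have key := hfam.sum_card_incident_add_two_le hop.2 (Y := Y) (Finset.card_pos.1 hX)
    fun z hz i hi e => Finset.disjoint_left.1 hdisj hi (Set.mem_singleton_iff.1 e ▸ hz)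
  have hedge : ∑ z ∈ Y, (incident G (fun v : V => ({v} : Set V)) X z).card =
      G.edgeSet.ncard := by
    rw [← coe_edgeFinset, Set.ncard_coe_finset, ← isBipartiteWith_sum_degrees_eq_card_edges' hB]
    refine Finset.sum_congr rfl fun z hz => ?_
    rw [← card_neighborFinset_eq_degree, isBipartiteWith_neighborFinset' hB hz]
    congr 1
    ext i
    simp [mem_incident]
  omega
end

section
/- For all n ≥ 15, the anti-Ramsey number of M_5 in the class of maximal outerplanar graphs of order n equals n + 4, i.e., ar(𝒪_n, M_5) = n + 4. -/
open SimpleGraph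

/-- The values of `r` order `P` linearly in such a way that no two edges of `G` cross. -/
def NoncrossingOn {V : Type*} (G : SimpleGraph V) (P : Set V) (r : V → ℤ) : Prop :=
  Set.InjOn r P ∧ ∀ ⦃a b c d : V⦄, a ∈ P → b ∈ P → c ∈ P → d ∈ P →
    r a < r b → r b < r c → r c < r d → G.Adj a c → ¬ G.Adj b d

theorem exists_adj_of_induce_connected {V : Type*} {G : SimpleGraph V} {X : Set V}
    (hX : (G.induce X).Connected) (p : V → Prop) {x y : V} (hx : x ∈ X) (hy : y ∈ X)
    (hpx : p x) (hpy : ¬ p y) : ∃ u ∈ X, ∃ v ∈ X, G.Adj u v ∧ p u ∧ ¬ p v := by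
  obtain ⟨w⟩ := hX.preconnected ⟨x, hx⟩ ⟨y, hy⟩
  obtain ⟨d, -, h1, h2⟩ := w.exists_boundary_dart {z | p z.1} hpx hpy
  exact ⟨d.fst, d.fst.2, d.snd, d.snd.2, d.adj, h1, h2⟩

theorem NoncrossingOn.not_crossing {V : Type*} {G : SimpleGraph V} {r : V → ℤ}
    (h : NoncrossingOn G Set.univ r) {X Y : Set V} (hX : (G.induce X).Connected)
    (hY : (G.induce Y).Connected) (hXY : Disjoint X Y) {x₁ y₁ x₂ y₂ : V} (hx₁ : x₁ ∈ X)
    (hy₁ : y₁ ∈ Y) (hx₂ : x₂ ∈ X) (hy₂ : y₂ ∈ Y) (h₁ : r x₁ < r y₁) (h₂ : r y₁ < r x₂) :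
    ¬ r x₂ < r y₂ := by
  intro h₃
  have hne : ∀ x ∈ X, ∀ y ∈ Y, r x ≠ r y := fun x hx y hy e =>
    Set.disjoint_left.1 hXY hx (h.1 trivial trivial e ▸ hy)
  have hnc : ∀ a b c d : V, r a < r b → r b < r c → r c < r d → G.Adj a c → ¬ G.Adj b d :=
    fun a b c d => h.2 trivial trivial trivial trivial
  obtain ⟨u, hu, v, hv, huv, ⟨pu1, pu2⟩, pv⟩ := exists_adj_of_induce_connected hX
    (fun x => r y₁ < r x ∧ r x < r y₂) hx₂ hx₁ ⟨h₂, h₃⟩ (by simp; omega)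
  have hv1 := hne v hv y₁ hy₁
  have hv2 := hne v hv y₂ hy₂
  rcases lt_or_ge (r v) (r y₁) with hlt | hge
  · obtain ⟨s, hs, t, ht, hst, ⟨ps1, ps2⟩, pt⟩ := exists_adj_of_induce_connected hY
      (fun x => r v < r x ∧ r x < r u) hy₁ hy₂ ⟨hlt, pu1⟩ (by simp; omega)
    have := hne v hv t ht
    have := hne u hu t ht
    rcases lt_or_ge (r t) (r v) with h4 | h4
    · exact hnc t v s u h4 ps1 ps2 hst.symm huv.symm
    · exact hnc v s u t ps1 ps2 (by omega) huv.symm hst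
  · have hgt : r y₂ < r v := by omega
    obtain ⟨s, hs, t, ht, hst, ⟨ps1, ps2⟩, pt⟩ := exists_adj_of_induce_connected hY
      (fun x => r u < r x ∧ r x < r v) hy₂ hy₁ ⟨pu2, hgt⟩ (by simp; omega)
    have := hne v hv t ht
    have := hne u hu t ht
    rcases lt_or_ge (r t) (r u) with h4 | h4
    · exact hnc t u s v h4 ps1 ps2 hst.symm huv
    · exact hnc u s v t ps1 ps2 (by omega) huv hst

theorem induce_union_connected_of_adj {V : Type*} {G : SimpleGraph V} {s t : Set V}
    (hs : (G.induce s).Connected) (ht : (G.induce t).Connected)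
    (h : ∃ u ∈ s, ∃ v ∈ t, G.Adj u v) : (G.induce (s ∪ t)).Connected := by
  obtain ⟨u, hu, v, hv, huv⟩ := h
  exact connected_induce_union hs.preconnected ht.preconnected hu hv huv

/-- A graph whose vertices can be ordered without crossing edges is outerplanar. -/
theorem NoncrossingOn.outerplanar {V : Type*} {G : SimpleGraph V} {r : V → ℤ}
    (h : NoncrossingOn G Set.univ r) : Outerplanar G := by
  constructor
  · rintro ⟨f, hne, hconn, hdisj, hadj⟩
    choose p hp using hne
    have hinj : Function.Injective (r ∘ p) := by
      intro i j hij
      by_contra hne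
      exact Set.disjoint_left.1 (hdisj hne) (hp i) (h.1 trivial trivial hij ▸ hp j)
    have hmono : StrictMono ((r ∘ p) ∘ Tuple.sort (r ∘ p)) :=
      (Tuple.monotone_sort _).strictMono_of_injective
        (hinj.comp (Tuple.sort (r ∘ p)).injective)
    set σ := Tuple.sort (r ∘ p)
    have hd : ∀ i j, i ≠ j → Disjoint (f (σ i)) (f (σ j)) := fun i j hij =>
      hdisj (σ.injective.ne hij)
    have hc : ∀ i j, i ≠ j → (G.induce (f (σ i) ∪ f (σ j))).Connected := fun i j hij =>
      induce_union_connected_of_adj (hconn _) (hconn _) (hadj (σ.injective.ne hij))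
    refine h.not_crossing (hc 0 2 (by decide)) (hc 1 3 (by decide)) ?_ (.inl (hp (σ 0)))
      (.inl (hp (σ 1))) (.inr (hp (σ 2))) (.inr (hp (σ 3))) (hmono (by decide))
      (hmono (by decide)) (hmono (by decide))
    simp only [Set.disjoint_union_left, Set.disjoint_union_right]
    exact ⟨⟨hd _ _ (by decide), hd _ _ (by decide)⟩, hd _ _ (by decide), hd _ _ (by decide)⟩
  · rintro ⟨f, hne, hconn, hdisj, hadj⟩
    choose p hp using hne
    have hinj : ∀ i j, i ≠ j → r (p i) ≠ r (p j) := by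
      intro i j hne hij
      exact Set.disjoint_left.1 (hdisj hne) (hp i) (h.1 trivial trivial hij ▸ hp j)
    have hc : ∀ i j, (G.induce (f (.inl i) ∪ f (.inr j))).Connected := fun i j =>
      induce_union_connected_of_adj (hconn _) (hconn _) (hadj (by simp))
    have hx : ∀ a a' b b', a ≠ a' → b ≠ b' → ∀ x₁ ∈ f (.inl a) ∪ f (.inr b),
        ∀ y₁ ∈ f (.inl a') ∪ f (.inr b'), ∀ x₂ ∈ f (.inl a) ∪ f (.inr b),
        ∀ y₂ ∈ f (.inl a') ∪ f (.inr b'), ¬ (r x₁ < r y₁ ∧ r y₁ < r x₂ ∧ r x₂ < r y₂) := by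
      rintro a a' b b' ha hb x₁ hx₁ y₁ hy₁ x₂ hx₂ y₂ hy₂ ⟨l₁, l₂, l₃⟩
      refine h.not_crossing (hc a b) (hc a' b') ?_ hx₁ hy₁ hx₂ hy₂ l₁ l₂ l₃
      simp only [Set.disjoint_union_left, Set.disjoint_union_right]
      exact ⟨⟨hdisj (by simpa), hdisj (by simp)⟩, hdisj (by simp), hdisj (by simpa)⟩
    obtain ⟨a, a', haa, hlt⟩ : ∃ a a' : Fin 2, a ≠ a' ∧ r (p (.inl a)) < r (p (.inl a')) := by
      rcases lt_or_gt_of_ne (hinj (.inl 0) (.inl 1) (by simp)) with h0 | h0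
      · exact ⟨0, 1, by decide, h0⟩
      · exact ⟨1, 0, by decide, h0⟩
    have key : ∀ b b', r (p (.inr b)) < r (p (.inr b')) →
        (r (p (.inl a)) < r (p (.inr b)) ∧ r (p (.inr b)) < r (p (.inl a')) ↔
          r (p (.inl a)) < r (p (.inr b')) ∧ r (p (.inr b')) < r (p (.inl a'))) → False := by
      intro b b' hbb hiff
      have hb : b ≠ b' := by rintro rfl; exact lt_irrefl _ hbb
      have n1 := hinj (.inl a) (.inr b) (by simp)
      have n2 := hinj (.inl a) (.inr b') (by simp)
      have n3 := hinj (.inl a') (.inr b) (by simp)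
      have n4 := hinj (.inl a') (.inr b') (by simp)
      have x1 := hx a a' b' b haa hb.symm _ (.inl (hp _)) _ (.inr (hp _)) _ (.inr (hp _)) _
        (.inl (hp _))
      have x2 := hx a a' b b' haa hb _ (.inr (hp _)) _ (.inr (hp _)) _ (.inl (hp _)) _
        (.inl (hp _))
      have x3 := hx a' a b b' haa.symm hb _ (.inr (hp _)) _ (.inl (hp _)) _ (.inl (hp _)) _
        (.inr (hp _))
      have x4 := hx a a' b b' haa hb _ (.inl (hp _)) _ (.inl (hp _)) _ (.inr (hp _)) _
        (.inr (hp _))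
      omega
    have key' : ∀ b b', b ≠ b' →
        (r (p (.inl a)) < r (p (.inr b)) ∧ r (p (.inr b)) < r (p (.inl a')) ↔
          r (p (.inl a)) < r (p (.inr b')) ∧ r (p (.inr b')) < r (p (.inl a'))) → False := by
      intro b b' hb hiff
      rcases lt_or_gt_of_ne (hinj (.inr b) (.inr b') (by simpa)) with h0 | h0
      · exact key b b' h0 hiff
      · exact key b' b h0 hiff.symm
    have k1 := key' 0 1 (by decide)
    have k2 := key' 0 2 (by decide)
    have k3 := key' 1 2 (by decide)
    tauto

theorem connected_induce_singleton {V : Type*} (G : SimpleGraph V) (x : V) :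
    (G.induce {x}).Connected := by
  rw [induce_singleton_eq_top]
  exact connected_top

theorem exists_adj_of_isChain_append {V : Type*} {G : SimpleGraph V} {A B : List V}
    (h : List.IsChain G.Adj (A ++ B)) (hA : A ≠ []) (hB : B ≠ []) :
    ∃ u ∈ A, ∃ v ∈ B, G.Adj u v :=
  ⟨A.getLast hA, List.getLast_mem hA, B.head hB, List.head_mem hB,
    (List.isChain_append.1 h).2.2 _ (List.getLast_mem_getLast? hA) _ (List.head_mem_head? hB)⟩

theorem connected_induce_of_isChain {V : Type*} {G : SimpleGraph V} {L : List V}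
    (h : List.IsChain G.Adj L) (hL : L ≠ []) : (G.induce {x | x ∈ L}).Connected := by
  induction L with
  | nil => exact absurd rfl hL
  | cons a L ih =>
    have ha := connected_induce_singleton G a
    rcases eq_or_ne L [] with rfl | hne
    · have e : {x | x ∈ [a]} = {a} := by ext; simp
      rw [e]
      exact ha
    · have h' : List.IsChain G.Adj ([a] ++ L) := h
      have := induce_union_connected_of_adj ha (ih (List.isChain_append.1 h').2.1 hne)
        (by simpa using exists_adj_of_isChain_append h' (by simp) hne)
      have e : {x | x ∈ a :: L} = {a} ∪ {x | x ∈ L} := by ext; simp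
      rw [e]
      exact this

theorem isChain_append_getLast {V : Type*} {G : SimpleGraph V} {A B : List V}
    (hc : Cycle.Chain G.Adj ((A ++ B : List V) : Cycle V)) (hA : A ≠ []) :
    List.IsChain G.Adj (A ++ B) ∧ (B ≠ [] → ∃ u ∈ B, ∃ v ∈ A, G.Adj u v) := by
  obtain ⟨a, A, rfl⟩ := List.exists_cons_of_ne_nil hA
  have h : List.IsChain G.Adj (((a :: A) ++ B) ++ [a]) := by
    rw [List.cons_append, Cycle.chain_coe_cons] at hc
    simpa using hc
  refine ⟨(List.isChain_append.1 h).1, fun hB => ?_⟩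
  rw [List.append_assoc] at h
  obtain ⟨u, hu, v, hv, huv⟩ :=
    exists_adj_of_isChain_append (List.isChain_append.1 h).2.1 hB (by simp)
  rw [List.mem_singleton] at hv
  exact ⟨u, hu, a, by simp, hv ▸ huv⟩

/-- Two crossing chords of a cycle give a `K₄` minor. -/
theorem hasMinor_completeGraph_of_crossing {V : Type*} {G : SimpleGraph V}
    {A B C D : List V} (hn : (A ++ (B ++ (C ++ D))).Nodup)
    (hc : Cycle.Chain G.Adj ((A ++ (B ++ (C ++ D)) : List V) : Cycle V))
    (hA : A ≠ []) (hB : B ≠ []) (hC : C ≠ []) (hD : D ≠ [])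
    (hAC : ∃ u ∈ A, ∃ v ∈ C, G.Adj u v) (hBD : ∃ u ∈ B, ∃ v ∈ D, G.Adj u v) :
    HasMinor G (completeGraph (Fin 4)) := by
  obtain ⟨h1, h2⟩ := isChain_append_getLast hc hA
  obtain ⟨cA, cB', hAB⟩ := List.isChain_append.1 h1
  obtain ⟨cB, cC', hBC⟩ := List.isChain_append.1 cB'
  obtain ⟨cC, cD, hCD⟩ := List.isChain_append.1 cC'
  have hCD := exists_adj_of_isChain_append cC' hC hD
  have hBC := exists_adj_of_isChain_append
    (by rw [← List.append_assoc] at cB'; exact (List.isChain_append.1 cB').1) hB hC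
  have hAB := exists_adj_of_isChain_append
    (by rw [← List.append_assoc] at h1; exact (List.isChain_append.1 h1).1) hA hB
  have hDA : ∃ u ∈ D, ∃ v ∈ A, G.Adj u v := by
    rw [← List.append_assoc, ← List.append_assoc] at hc
    have hr : ((A ++ B ++ C ++ D : List V) : Cycle V) = ((D ++ (A ++ B ++ C) : List V) : Cycle V) :=
      Cycle.coe_eq_coe.2 List.isRotated_append
    rw [hr] at hc
    have := (isChain_append_getLast hc hD).1
    simp only [← List.append_assoc] at this
    exact exists_adj_of_isChain_append
      (List.isChain_append.1 (List.isChain_append.1 this).1).1 hD hA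
  have symm' : ∀ {X Y : List V}, (∃ u ∈ X, ∃ v ∈ Y, G.Adj u v) → ∃ u ∈ Y, ∃ v ∈ X, G.Adj u v :=
    fun ⟨u, hu, v, hv, h⟩ => ⟨v, hv, u, hu, h.symm⟩
  refine ⟨![{x | x ∈ A}, {x | x ∈ B}, {x | x ∈ C}, {x | x ∈ D}], ?_, ?_, ?_, ?_⟩
  · intro w
    fin_cases w
    exacts [List.exists_mem_of_ne_nil _ hA, List.exists_mem_of_ne_nil _ hB,
      List.exists_mem_of_ne_nil _ hC, List.exists_mem_of_ne_nil _ hD]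
  · intro w
    fin_cases w
    exacts [connected_induce_of_isChain cA hA, connected_induce_of_isChain cB hB,
      connected_induce_of_isChain cC hC, connected_induce_of_isChain cD hD]
  · simp only [List.nodup_append, List.mem_append] at hn
    intro i j hij
    rw [Set.disjoint_left]
    fin_cases i <;> fin_cases j <;> first | exact absurd rfl hij | skip
    all_goals simp; grind
  · intro i j hij
    have := hij.ne
    fin_cases i <;> fin_cases j <;> first | exact absurd rfl this | skip
    exacts [hAB, hAC, symm' hDA, symm' hAB, hBC, hBD, symm' hAC, symm' hBC, hCD, hDA,
      symm' hBD, symm' hCD]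

/-- A cycle through `a` and `b`, both arcs between them nonempty, together with a connected set
off the cycle touching both `a` and `b`, gives a `K_{2,3}` minor. -/
theorem hasMinor_completeBipartiteGraph_of_cycle {V : Type*} {G : SimpleGraph V}
    {A B : List V} {a b : V} {D : Set V} (hn : (a :: (A ++ b :: B)).Nodup)
    (hc : Cycle.Chain G.Adj ((a :: (A ++ b :: B) : List V) : Cycle V))
    (hA : A ≠ []) (hB : B ≠ []) (hD : (G.induce D).Connected)
    (hdis : ∀ x ∈ a :: (A ++ b :: B), x ∉ D)
    (haD : ∃ d ∈ D, G.Adj a d) (hbD : ∃ d ∈ D, G.Adj b d) :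
    HasMinor G (completeBipartiteGraph (Fin 2) (Fin 3)) := by
  have one := connected_induce_singleton G
  rw [Cycle.chain_coe_cons] at hc
  have c1 : List.IsChain G.Adj ([a] ++ (A ++ ([b] ++ (B ++ [a])))) := by simpa using hc
  obtain ⟨-, c2, -⟩ := List.isChain_append.1 c1
  obtain ⟨cA, c3, -⟩ := List.isChain_append.1 c2
  obtain ⟨-, c4, -⟩ := List.isChain_append.1 c3
  obtain ⟨cB, -, -⟩ := List.isChain_append.1 c4
  have haA : ∃ v ∈ A, G.Adj a v := by
    rw [← List.append_assoc] at c1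
    simpa using exists_adj_of_isChain_append (List.isChain_append.1 c1).1 (by simp) hA
  have hAb : ∃ v ∈ A, G.Adj b v := by
    rw [← List.append_assoc] at c2
    simpa [G.adj_comm] using exists_adj_of_isChain_append (List.isChain_append.1 c2).1 hA (by simp)
  have hbB : ∃ v ∈ B, G.Adj b v := by
    rw [← List.append_assoc] at c3
    simpa using exists_adj_of_isChain_append (List.isChain_append.1 c3).1 (by simp) hB
  have hBa : ∃ v ∈ B, G.Adj a v := by
    simpa [G.adj_comm] using exists_adj_of_isChain_append c4 hB (by simp)
  have hall : ∀ i j, ∃ v₁ ∈ (![{a}, {b}] : Fin 2 → Set V) i,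
      ∃ v₂ ∈ (![D, {x | x ∈ A}, {x | x ∈ B}] : Fin 3 → Set V) j, G.Adj v₁ v₂ := by
    intro i j
    fin_cases i <;> fin_cases j
    exacts [⟨a, rfl, haD⟩, ⟨a, rfl, haA⟩, ⟨a, rfl, hBa⟩, ⟨b, rfl, hbD⟩, ⟨b, rfl, hAb⟩,
      ⟨b, rfl, hbB⟩]
  refine ⟨Sum.elim ![{a}, {b}] ![D, {x | x ∈ A}, {x | x ∈ B}], ?_, ?_, ?_, ?_⟩
  · rintro (w | w) <;> fin_cases w
    exacts [⟨a, rfl⟩, ⟨b, rfl⟩, haD.imp fun _ h => h.1, List.exists_mem_of_ne_nil _ hA,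
      List.exists_mem_of_ne_nil _ hB]
  · rintro (w | w) <;> fin_cases w
    exacts [one a, one b, hD, connected_induce_of_isChain cA hA, connected_induce_of_isChain cB hB]
  · simp only [List.nodup_cons, List.nodup_append, List.mem_append, List.mem_cons] at hn hdis
    rintro (i | i) (j | j) hij <;>
      refine Set.disjoint_left.2 ?_ <;>
      fin_cases i <;> fin_cases j <;> first | exact absurd rfl hij | skip
    all_goals simp; grind
  · rintro (i | i) (j | j) hij
    · simp at hij
    · exact hall i j
    · obtain ⟨u, hu, v, hv, h⟩ := hall j i
      exact ⟨v, hv, u, hu, h.symm⟩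
    · simp at hij

theorem NoncrossingOn.neg {V : Type*} {G : SimpleGraph V} {P : Set V} {r : V → ℤ}
    (h : NoncrossingOn G P r) : NoncrossingOn G P (fun x => -r x) := by
  refine ⟨fun x hx y hy e => h.1 hx hy (by simpa using e), ?_⟩
  intro a b c d ha hb hc hd h1 h2 h3 h4 h5
  exact h.2 hd hc hb ha (neg_lt_neg_iff.1 h3) (neg_lt_neg_iff.1 h2) (neg_lt_neg_iff.1 h1)
    h5.symm h4.symm

/-- A non-crossing order can be rotated cyclically so that a prescribed vertex comes last. -/
theorem NoncrossingOn.exists_last {V : Type*} {G : SimpleGraph V} {P : Finset V} {r : V → ℤ}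
    (h : NoncrossingOn G P r) {a : V} (ha : a ∈ P) :
    ∃ r', NoncrossingOn G P r' ∧ r' a = 0 ∧ ∀ x ∈ P, r' x ≤ 0 := by
  obtain ⟨N, hN⟩ : ∃ N, ∀ x ∈ P, |r x| ≤ N := by
    obtain ⟨N, hN⟩ := (P.image fun x => |r x|).bddAbove
    exact ⟨N, fun x hx => hN (by simpa using ⟨x, hx, rfl⟩)⟩
  refine ⟨fun x => if r x ≤ r a then r x - r a else r x - r a - (2 * N + 1), ⟨?_, ?_⟩, by simp, ?_⟩
  · intro x hx y hy hxy
    have h1 := abs_le.1 (hN x hx)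
    have h2 := abs_le.1 (hN y hy)
    apply h.1 hx hy
    simp only at hxy
    split_ifs at hxy <;> omega
  · intro w x y z hw hx hy hz h1 h2 h3 h4 h5
    have b1 := abs_le.1 (hN w hw)
    have b2 := abs_le.1 (hN x hx)
    have b3 := abs_le.1 (hN y hy)
    have b4 := abs_le.1 (hN z hz)
    have k1 := h.2 hw hx hy hz
    have k2 := h.2 hx hy hz hw
    have k3 := h.2 hy hz hw hx
    have k4 := h.2 hz hw hx hy
    simp only [h4, h5, h4.symm, h5.symm, not_true_eq_false, imp_false] at k1 k2 k3 k4
    simp only at h1 h2 h3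
    split_ifs at h1 h2 h3 <;> omega
  · intro x hx
    have b1 := abs_le.1 (hN x hx)
    have b2 := abs_le.1 (hN a ha)
    simp only
    split_ifs <;> omega

/-- Non-crossing orders of two pieces sharing one vertex `a` can be concatenated. -/
theorem NoncrossingOn.exists_glue {V : Type*} {G : SimpleGraph V} {P Q R : Finset V}
    {r s : V → ℤ} (hr : NoncrossingOn G P r) (hs : NoncrossingOn G Q s) {a : V} (haP : a ∈ P)
    (haQ : a ∈ Q) (hPQ : ∀ x ∈ P, x ∈ Q → x = a)
    (hR : ∀ x ∈ R, x ∈ P ∨ x ∈ Q)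
    (hE : ∀ x ∈ R, ∀ y ∈ R, G.Adj x y → x ∈ P ∧ y ∈ P ∨ x ∈ Q ∧ y ∈ Q) :
    ∃ t, NoncrossingOn G R t := by
  classical
  obtain ⟨r', hr', ra, rle⟩ := hr.exists_last haP
  obtain ⟨s', hs', sa, sle⟩ := hs.exists_last haQ
  set t : V → ℤ := fun x => if x ∈ P then r' x else - s' x with ht
  have tP : ∀ x ∈ P, t x = r' x := fun x hx => by simp [ht, hx]
  have tQ : ∀ x ∈ Q, t x = - s' x := fun x hx => by
    by_cases hxP : x ∈ P
    · obtain rfl := hPQ x hxP hx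
      simp [ht, hxP, ra, sa]
    · simp [ht, hxP]
  have tinj : Set.InjOn t R := by
    have aux : ∀ x ∈ P, ∀ y ∈ Q, t x = t y → x = y := by
      intro x hx y hy e
      have e1 := rle x hx
      have e2 := sle y hy
      rw [tP x hx, tQ y hy] at e
      have e3 : x = a := hr'.1 hx haP (by omega)
      have e4 : y = a := hs'.1 hy haQ (by omega)
      rw [e3, e4]
    intro x hx y hy e
    rcases hR x hx with h1 | h1 <;> rcases hR y hy with h2 | h2
    · exact hr'.1 h1 h2 (by rwa [tP x h1, tP y h2] at e)
    · exact aux x h1 y h2 e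
    · exact (aux y h2 x h1 e.symm).symm
    · exact hs'.1 h1 h2 (by rw [tQ x h1, tQ y h2] at e; omega)
  refine ⟨t, tinj, ?_⟩
  intro w x y z hw hx hy hz h1 h2 h3 h4 h5
  rcases hE w hw y hy h4 with ⟨m1, m2⟩ | ⟨m1, m2⟩ <;>
    rcases hE x hx z hz h5 with ⟨m3, m4⟩ | ⟨m3, m4⟩
  · rw [tP _ m1, tP _ m3] at h1
    rw [tP _ m3, tP _ m2] at h2
    rw [tP _ m2, tP _ m4] at h3
    exact hr'.2 m1 m3 m2 m4 h1 h2 h3 h4 h5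
  · have := rle y m2
    have := sle x m3
    rw [tQ _ m3, tP _ m2] at h2
    omega
  · have := rle z m4
    have := sle y m2
    rw [tQ _ m2, tP _ m4] at h3
    omega
  · rw [tQ _ m1, tQ _ m3] at h1
    rw [tQ _ m3, tQ _ m2] at h2
    rw [tQ _ m2, tQ _ m4] at h3
    exact hs'.neg.2 m1 m3 m2 m4 h1 h2 h3 h4 h5

theorem exists_path_through {V : Type*} {G : SimpleGraph V} {D : Set V}
    (hD : (G.induce D).Connected) {a b : V} (ha : ∃ d ∈ D, G.Adj a d) (hb : ∃ d ∈ D, G.Adj b d) :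
    ∃ L : List V, L ≠ [] ∧ L.Nodup ∧ (∀ x ∈ L, x ∈ D) ∧ List.IsChain G.Adj (a :: (L ++ [b])) := by
  obtain ⟨d, hd, had⟩ := ha
  obtain ⟨e, he, hbe⟩ := hb
  obtain ⟨p, hp⟩ := (hD.preconnected ⟨d, hd⟩ ⟨e, he⟩).exists_isPath
  obtain ⟨q, hq⟩ : ∃ q : G.Walk d e, q.support = p.support.map Subtype.val :=
    ⟨p.map (Embedding.induce D).toHom, Walk.support_map _ _⟩
  refine ⟨p.support.map Subtype.val, fun h => p.support_ne_nil (List.map_eq_nil_iff.1 h), hp.support_nodup.map Subtype.val_injective,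
    by simp +contextual, ?_⟩
  have := (Walk.cons had (q.concat hbe.symm)).isChain_adj_support
  rw [Walk.support_cons, Walk.support_concat, hq] at this
  simpa [List.concat_eq_append] using this

/-- A component of the complement of a cycle attached to two vertices of the cycle allows one to
enlarge the cycle, unless there is a `K_{2,3}` minor. -/
theorem exists_longer_cycle {V : Type*} {G : SimpleGraph V}
    (hG : ¬ HasMinor G (completeBipartiteGraph (Fin 2) (Fin 3))) {C : List V} (hn : C.Nodup)
    (hc : Cycle.Chain G.Adj (C : Cycle V)) {D : Set V} (hD : (G.induce D).Connected)
    (hdis : ∀ x ∈ C, x ∉ D) {a b : V} (hab : a ≠ b) (ha : a ∈ C) (hb : b ∈ C)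
    (haD : ∃ d ∈ D, G.Adj a d) (hbD : ∃ d ∈ D, G.Adj b d) :
    ∃ C' : List V, C'.Nodup ∧ Cycle.Chain G.Adj (C' : Cycle V) ∧ C.length < C'.length ∧
      ∀ x ∈ C', x ∈ C ∨ x ∈ D := by
  have key : ∀ (a b : V) (B : List V), (a :: b :: B).Nodup →
      Cycle.Chain G.Adj ((a :: b :: B : List V) : Cycle V) → (∀ x ∈ a :: b :: B, x ∈ C) →
      C.length = (a :: b :: B).length → (∃ d ∈ D, G.Adj a d) → (∃ d ∈ D, G.Adj b d) →
      ∃ C' : List V, C'.Nodup ∧ Cycle.Chain G.Adj (C' : Cycle V) ∧ C.length < C'.length ∧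
        ∀ x ∈ C', x ∈ C ∨ x ∈ D := by
    intro a b B hn hc hsub hlen haD hbD
    obtain ⟨L, hL0, hLn, hLD, hLc⟩ := exists_path_through hD haD hbD
    refine ⟨a :: (L ++ b :: B), ?_, ?_, ?_, ?_⟩
    · have : ∀ x ∈ L, x ∉ a :: b :: B := fun x hx hx' => hdis x (hsub x hx') (hLD x hx)
      simp only [List.nodup_cons, List.nodup_append, List.mem_append, List.mem_cons] at hn this ⊢
      grind
    · rw [Cycle.chain_coe_cons] at hc ⊢
      have h1 : List.IsChain G.Adj ((a :: L) ++ [b]) := hLc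
      have h2 : List.IsChain G.Adj ([b] ++ (B ++ [a])) := (List.isChain_cons.1 hc).2
      simpa using h1.append_overlap h2 (by simp)
    · have := List.length_pos_iff.2 hL0
      simp only [List.length_cons, List.length_append] at hlen ⊢
      omega
    · intro x hx
      simp only [List.mem_cons, List.mem_append] at hx hsub
      rcases hx with h | h | h | h
      exacts [.inl (hsub x (.inl h)), .inr (hLD x h), .inl (hsub x (.inr (.inl h))),
        .inl (hsub x (.inr (.inr h)))]
  obtain ⟨S, T, rfl⟩ := List.append_of_mem ha
  have hr : (S ++ a :: T) ~r (a :: (T ++ S)) := by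
    simpa using List.isRotated_append (l := S) (l' := a :: T)
  have hb' : b ∈ T ++ S := by
    have := hr.mem_iff.1 hb
    simpa [hab.symm] using this
  obtain ⟨A, B, hAB⟩ := List.append_of_mem hb'
  rw [hAB] at hr
  have hn' := hr.nodup_iff.1 hn
  have hc' := hc
  rw [Cycle.coe_eq_coe.2 hr] at hc'
  have hl := hr.perm.length_eq
  have hm := fun x => hr.mem_iff (a := x)
  rcases eq_or_ne A [] with rfl | hA
  · exact key a b B hn' hc' (fun x hx => (hm x).2 hx) hl haD hbD
  rcases eq_or_ne B [] with rfl | hB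
  · have hr2 : (a :: (A ++ [b])) ~r (b :: a :: A) := by
      simpa using List.isRotated_append (l := a :: A) (l' := [b])
    refine key b a A (hr2.nodup_iff.1 hn') ?_ (fun x hx => (hm x).2 (hr2.mem_iff.2 hx)) ?_ hbD haD
    · rwa [Cycle.coe_eq_coe.2 hr2] at hc'
    · rw [hl, hr2.perm.length_eq]
  · exact absurd (hasMinor_completeBipartiteGraph_of_cycle hn' hc' hA hB hD
      (fun x hx => hdis x ((hm x).2 hx)) haD hbD) hG

/-- The order along a cycle through all vertices of `P` is non-crossing. -/
theorem noncrossingOn_of_cycle {V : Type*} [DecidableEq V] {G : SimpleGraph V}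
    (hG : ¬ HasMinor G (completeGraph (Fin 4))) {C : List V} (hn : C.Nodup)
    (hc : Cycle.Chain G.Adj (C : Cycle V)) {P : Set V} (hP : ∀ x ∈ P, x ∈ C) :
    NoncrossingOn G P (fun x => (C.idxOf x : ℤ)) := by
  constructor
  · intro x hx y hy h
    exact (List.idxOf_inj (hP x hx)).1 (Int.ofNat_inj.1 h)
  · intro a b c d ha hb hc' hd h1 h2 h3 hac hbd
    have ia := List.idxOf_lt_length_of_mem (hP a ha)
    have ib := List.idxOf_lt_length_of_mem (hP b hb)
    have ic := List.idxOf_lt_length_of_mem (hP c hc')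
    have id := List.idxOf_lt_length_of_mem (hP d hd)
    have ga := List.getElem_idxOf ia
    have gb := List.getElem_idxOf ib
    have gc := List.getElem_idxOf ic
    have gd := List.getElem_idxOf id
    simp only [Nat.cast_lt] at h1 h2 h3
    generalize C.idxOf a = i at *
    generalize C.idxOf b = j at *
    generalize C.idxOf c = k at *
    generalize C.idxOf d = l at *
    have eq : C = C.take j ++ ((C.drop j).take (k - j) ++ ((C.drop k).take (l - k) ++ C.drop l)) := by
      have e1 : (C.drop k).take (l - k) ++ C.drop l = C.drop k := by
        conv_rhs => rw [← List.take_append_drop (l - k) (C.drop k), List.drop_drop]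
        congr 2; omega
      have e2 : (C.drop j).take (k - j) ++ C.drop k = C.drop j := by
        conv_rhs => rw [← List.take_append_drop (k - j) (C.drop j), List.drop_drop]
        congr 2; omega
      rw [e1, e2, List.take_append_drop]
    have ma : a ∈ C.take j := by
      rw [List.mem_iff_getElem]
      exact ⟨i, by simp; omega, by simpa using ga⟩
    have mb : b ∈ (C.drop j).take (k - j) := by
      rw [List.mem_iff_getElem]
      exact ⟨0, by simp; omega, by simpa using gb⟩
    have mc : c ∈ (C.drop k).take (l - k) := by
      rw [List.mem_iff_getElem]
      exact ⟨0, by simp; omega, by simpa using gc⟩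
    have md : d ∈ C.drop l := by
      rw [List.mem_iff_getElem]
      exact ⟨0, by simp; omega, by simpa using gd⟩
    rw [eq] at hn hc
    exact hG (hasMinor_completeGraph_of_crossing hn hc (List.ne_nil_of_mem ma)
      (List.ne_nil_of_mem mb) (List.ne_nil_of_mem mc) (List.ne_nil_of_mem md)
      ⟨a, ma, c, mc, hac⟩ ⟨b, mb, d, md, hbd⟩)

/-- The vertices of an outerplanar graph can be ordered without crossing edges. -/
theorem Outerplanar.exists_noncrossingOn {V : Type*} {G : SimpleGraph V} (hG : Outerplanar G)
    (P : Finset V) : ∃ r, NoncrossingOn G P r := by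
  classical
  induction P using Finset.strongInduction with
  | H P ih =>
  by_cases hedge : ∃ a ∈ P, ∃ b ∈ P, G.Adj a b
  · have main : ∀ m, ∀ C : List V, C.Nodup → Cycle.Chain G.Adj (C : Cycle V) →
        (∀ x ∈ C, x ∈ P) → 2 ≤ C.length → P.card < C.length + m → ∃ r, NoncrossingOn G P r := by
      intro m
      induction m with
      | zero =>
        intro C hn _ hP _ hlt
        have := Finset.card_le_card (s := C.toFinset) (t := P) (fun x hx => hP x (by simpa using hx))
        rw [List.toFinset_card_of_nodup hn] at this
        omega
      | succ m ihm =>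
        intro C hn hc hP h2 hlt
        by_cases hv : ∀ x ∈ P, x ∈ C
        · exact ⟨_, noncrossingOn_of_cycle hG.1 hn hc hv⟩
        push Not at hv
        obtain ⟨v, hvP, hvC⟩ := hv
        obtain ⟨D, hDmem, hDmax⟩ := Finset.exists_max_image
          (P.powerset.filter fun D : Finset V => (∀ x ∈ C, x ∉ D) ∧ v ∈ D ∧
            (G.induce (D : Set V)).Connected) Finset.card
          ⟨{v}, by
            simp only [Finset.mem_filter, Finset.mem_powerset, Finset.singleton_subset_iff,
              Finset.mem_singleton]
            exact ⟨hvP, fun x hx h => hvC (h ▸ hx), trivial,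
              (Finset.coe_singleton v).symm ▸ connected_induce_singleton G v⟩⟩
        simp only [Finset.mem_filter, Finset.mem_powerset] at hDmem hDmax
        obtain ⟨hDP, hDC, hvD, hDconn⟩ := hDmem
        have hclosed : ∀ x ∈ D, ∀ y ∈ P, y ∉ C → G.Adj x y → y ∈ D := by
          intro x hx y hy hyC hxy
          by_contra hyD
          have := hDmax (insert y D) ⟨Finset.insert_subset hy hDP, ?_, by simp [hvD], ?_⟩
          · rw [Finset.card_insert_of_notMem hyD] at this
            omega
          · intro z hz h
            rcases Finset.mem_insert.1 h with rfl | h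
            exacts [hyC hz, hDC z hz h]
          · rw [Finset.coe_insert, Set.insert_eq]
            exact induce_union_connected_of_adj (connected_induce_singleton G y) hDconn ⟨y, rfl, x, hx, hxy.symm⟩
        by_cases hatt : ∃ a ∈ C, ∃ b ∈ C, a ≠ b ∧ (∃ d ∈ (D : Set V), G.Adj a d) ∧
            ∃ d ∈ (D : Set V), G.Adj b d
        · obtain ⟨a, ha, b, hb, hab, haD, hbD⟩ := hatt
          obtain ⟨C', hn', hc', hlen, hsub⟩ :=
            exists_longer_cycle hG.2 hn hc hDconn (by simpa using hDC) hab ha hb haD hbD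
          exact ihm C' hn' hc' (fun x hx => (hsub x hx).elim (hP x) (fun h => hDP h)) (by omega)
            (by omega)
        · obtain ⟨a, haC, hatt⟩ : ∃ a ∈ C, ∀ b ∈ C, (∃ d ∈ D, G.Adj b d) → b = a := by
            by_cases h : ∃ a ∈ C, ∃ d ∈ D, G.Adj a d
            · obtain ⟨a, ha, had⟩ := h
              refine ⟨a, ha, fun b hb hbd => ?_⟩
              by_contra hne
              exact hatt ⟨b, hb, a, ha, hne, hbd, had⟩
            · obtain ⟨a, ha⟩ := List.exists_mem_of_length_pos (l := C) (by omega)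
              exact ⟨a, ha, fun b hb hbd => absurd ⟨b, hb, hbd⟩ h⟩
          obtain ⟨c, hcC, hca⟩ : ∃ c ∈ C, c ≠ a := by
            by_contra hcon
            push Not at hcon
            have := List.toFinset_card_of_nodup hn
            have h3 : C.toFinset ⊆ {a} := fun x hx => by simpa using hcon x (by simpa using hx)
            have := Finset.card_le_card h3
            simp only [Finset.card_singleton] at this
            omega
          have haD := hDC a haC
          obtain ⟨r, hr⟩ := ih (insert a D) (by
            refine ⟨Finset.insert_subset (hP a haC) hDP, fun h => ?_⟩
            have := h (hP c hcC)
            simp [hca, hDC c hcC] at this)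
          obtain ⟨s, hs⟩ := ih (P \ D) (by
            refine ⟨Finset.sdiff_subset, fun h => ?_⟩
            have := h hvP
            simp [hvD] at this)
          have hcross : ∀ x ∈ D, ∀ y ∈ P, y ∉ D → G.Adj x y → y = a := by
            intro x hx y hy hyD hxy
            by_cases hyC : y ∈ C
            · exact hatt y hyC ⟨x, hx, hxy.symm⟩
            · exact absurd (hclosed x hx y hy hyC hxy) hyD
          refine hr.exists_glue hs (a := a) (by simp) (by simp [hP a haC, haD]) ?_ ?_ ?_
          · simp +contextual
          · intro x hx
            by_cases h : x ∈ D <;> simp [h, hx]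
          · intro x hx y hy hxy
            by_cases h1 : x ∈ D <;> by_cases h2 : y ∈ D
            · simp [h1, h2]
            · simp [h1, hcross x h1 y hy h2 hxy]
            · simp [h2, hcross y h2 x hx h1 hxy.symm]
            · simp [h1, h2, hx, hy]
    obtain ⟨a, ha, b, hb, hab⟩ := hedge
    refine main (P.card + 1) [a, b] (by simp [hab.ne]) ?_ (by simp [ha, hb]) (by simp)
      (by simp; omega)
    rw [Cycle.chain_coe_cons]
    simp [hab, hab.symm]
  · let e := (Finset.equivFin P)
    refine ⟨fun x => if h : x ∈ P then (e ⟨x, h⟩ : ℕ) else 0, ?_, ?_⟩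
    · intro x hx y hy h
      rw [Finset.mem_coe] at hx hy
      simp only [hx, hy, dif_pos] at h
      have := e.injective (Fin.ext (by exact_mod_cast h))
      simpa using this
    · intro a b c d ha _ hc _ _ _ _ h
      exact absurd ⟨a, ha, c, hc, h⟩ hedge

theorem ZMod.exists_mem_sub_one_notMem {n : ℕ} [NeZero n] {R : Finset (ZMod n)} (h : R.Nonempty)
    (hR : R ≠ Finset.univ) : ∃ e ∈ R, e - 1 ∉ R := by
  by_contra! hcon
  obtain ⟨e, he⟩ := h
  have hall : ∀ m : ℕ, e - m ∈ R := by
    intro m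
    induction m with
    | zero => simpa using he
    | succ m ih =>
      have := hcon _ ih
      rwa [sub_sub, ← Nat.cast_succ] at this
  refine hR (Finset.eq_univ_iff_forall.2 fun x => ?_)
  simpa using hall (e - x).val

/-- A proper set of at least `2 * k - 1` edges of a cycle contains a matching of size `k`. -/
theorem ZMod.exists_independent_subset {n : ℕ} [NeZero n] (k : ℕ) (R : Finset (ZMod n))
    (hR : R ≠ Finset.univ) (hk : 2 * k ≤ R.card + 1) :
    ∃ I ⊆ R, I.card = k ∧ ∀ i ∈ I, i + 1 ∉ I := by
  induction k generalizing R with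
  | zero => exact ⟨∅, by simp⟩
  | succ k ih =>
    obtain ⟨e, he, he'⟩ := exists_mem_sub_one_notMem (Finset.card_pos.1 (by omega)) hR
    obtain ⟨I, hIR, hI, hind⟩ := ih ((R.erase e).erase (e + 1)) (fun h => by
      have := h ▸ Finset.mem_univ e
      simp at this) (by
      have h1 := Finset.card_erase_of_mem he
      have h2 := Finset.pred_card_le_card_erase (s := R.erase e) (a := e + 1)
      omega)
    have hsub : ∀ i ∈ I, i ≠ e + 1 ∧ i ≠ e ∧ i ∈ R := fun i hi => by simpa using hIR hi
    refine ⟨insert e I, ?_, ?_, ?_⟩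
    · intro i hi
      rcases Finset.mem_insert.1 hi with rfl | hi
      exacts [he, (hsub i hi).2.2]
    · rw [Finset.card_insert_of_notMem fun h => (hsub e h).2.1 rfl, hI]
    · intro i hi hi'
      rcases Finset.mem_insert.1 hi with rfl | hi <;> rcases Finset.mem_insert.1 hi' with h | h
      · exact he' (by rwa [sub_eq_of_eq_add h.symm])
      · exact (hsub _ h).1 rfl
      · exact he' (by rw [← h]; simpa using (hsub i hi).2.2)
      · exact hind i hi h

/-- A matching `J` inside a part `T` of `R`, not touching the rest of `R`, can be completed by a
matching of the rest. -/
theorem ZMod.exists_independent_of_part {n : ℕ} [NeZero n] (k : ℕ) {R T J : Finset (ZMod n)}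
    (hT : T ⊆ R) (hJ : J ⊆ T) (hne : J.Nonempty) (hJind : ∀ j ∈ J, j + 1 ∉ J)
    (hout : ∀ j ∈ J, ∀ i ∈ R, i ∉ T → i + 1 ≠ j ∧ j + 1 ≠ i) (hk : 2 * k + T.card ≤ R.card + 1) :
    ∃ I ⊆ R, I.card = k + J.card ∧ ∀ i ∈ I, i + 1 ∉ I := by
  obtain ⟨I, hIR, hI, hind⟩ := exists_independent_subset k (R \ T) (fun h => by
    obtain ⟨j, hj⟩ := hne
    have := h ▸ Finset.mem_univ j
    simp [hJ hj] at this) (by rw [Finset.card_sdiff_of_subset hT]; omega)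
  have hsub : ∀ i ∈ I, i ∈ R ∧ i ∉ T := fun i hi => by simpa using hIR hi
  refine ⟨I ∪ J, ?_, ?_, ?_⟩
  · exact Finset.union_subset (fun i hi => (hsub i hi).1) (hJ.trans hT)
  · rw [Finset.card_union_of_disjoint, hI]
    exact Finset.disjoint_left.2 fun i hi hj => (hsub i hi).2 (hJ hj)
  · intro i hi hi'
    rcases Finset.mem_union.1 hi with h | h <;> rcases Finset.mem_union.1 hi' with h' | h'
    · exact hind i h h'
    · exact (hout _ h' i (hsub i h).1 (hsub i h).2).1 rfl
    · exact (hout _ h _ (hsub _ h').1 (hsub _ h').2).2 rfl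
    · exact hJind i h h'

theorem ZMod.card_filter_add_one {n : ℕ} [NeZero n] (p : ZMod n → Prop) [DecidablePred p] :
    (Finset.univ.filter fun i => p (i + 1)).card = (Finset.univ.filter p).card :=
  Finset.card_equiv (Equiv.addRight 1) (by simp)

/-- A cycle of length at least `15` whose edges carry at least eight colours has a rainbow
matching of size five. -/
theorem ZMod.exists_rainbow_independent {n : ℕ} [NeZero n] (hn : 15 ≤ n) (col : ZMod n → ℕ)
    (hcol : 8 ≤ (Finset.univ.image col).card) :
    ∃ I : Finset (ZMod n), I.card = 5 ∧ Set.InjOn col I ∧ ∀ i ∈ I, i + 1 ∉ I := by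
  by_contra hcon
  have hno : ∀ I R : Finset (ZMod n), Set.InjOn col R → I ⊆ R → I.card = 5 →
      (∀ i ∈ I, i + 1 ∉ I) → False := fun I R hR hIR hI hind =>
    hcon ⟨I, hI, hR.mono (by exact_mod_cast hIR), hind⟩
  have hcast : ∀ k : ℕ, 0 < k → k < 15 → (k : ZMod n) ≠ 0 := by
    intro k hk hk' h
    have := Nat.le_of_dvd hk ((ZMod.natCast_eq_zero_iff k n).1 h)
    omega
  have n1 : (1 : ZMod n) ≠ 0 := by exact_mod_cast hcast 1 (by norm_num) (by norm_num)
  have n2 : (2 : ZMod n) ≠ 0 := by exact_mod_cast hcast 2 (by norm_num) (by norm_num)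
  have n3 : (3 : ZMod n) ≠ 0 := by exact_mod_cast hcast 3 (by norm_num) (by norm_num)
  have n4 : (4 : ZMod n) ≠ 0 := by exact_mod_cast hcast 4 (by norm_num) (by norm_num)
  have n7 : (7 : ZMod n) ≠ 0 := by exact_mod_cast hcast 7 (by norm_num) (by norm_num)
  have hcard : (Finset.univ : Finset (ZMod n)).card = n := by simp [ZMod.card]
  have no9 : ∀ R : Finset (ZMod n), Set.InjOn col R → R.card = 9 → False := by
    intro R hR h9
    obtain ⟨I, hIR, hI, hind⟩ := exists_independent_subset 5 R (by
      rintro rfl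
      omega) (by omega)
    exact hno I R hR hIR hI hind
  have single : ∀ R : Finset (ZMod n), Set.InjOn col R → R.card = 8 → ∀ e ∈ R,
      e - 1 ∈ R ∨ e + 1 ∈ R := by
    intro R hR h8 e he
    by_contra! hout
    obtain ⟨I, hIR, hI, hind⟩ := exists_independent_of_part 4 (R := R) (T := {e}) (J := {e})
      (by simpa using he) (by simp) (by simp) (by simpa using n1) (by
        intro j hj i hi _
        rw [Finset.mem_singleton] at hj
        subst hj
        exact ⟨fun h => hout.1 (by rwa [← h, add_sub_cancel_right]), fun h => hout.2 (h ▸ hi)⟩)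
      (by simp [h8])
    exact hno I R hR hIR (by simp [hI]) hind
  have triple : ∀ R : Finset (ZMod n), Set.InjOn col R → R.card = 8 → ∀ e ∈ R,
      e + 1 ∈ R → e + 2 ∈ R → e - 1 ∉ R → e + 3 ∉ R → False := by
    intro R hR h8 e he he1 he2 hl hr
    obtain ⟨I, hIR, hI, hind⟩ := exists_independent_of_part 3 (R := R) (T := {e, e + 1, e + 2})
      (J := {e, e + 2}) (by
        intro i hi
        simp only [Finset.mem_insert, Finset.mem_singleton] at hi
        rcases hi with rfl | rfl | rfl <;> assumption) (by
        intro i hi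
        simp only [Finset.mem_insert, Finset.mem_singleton] at hi ⊢
        tauto) (by simp) (by
        intro j hj hj'
        simp only [Finset.mem_insert, Finset.mem_singleton] at hj hj'
        grind) (by
        intro j hj i hi hiT
        simp only [Finset.mem_insert, Finset.mem_singleton] at hj hiT
        refine ⟨?_, ?_⟩ <;> rintro rfl <;> grind) (by
        have := Finset.card_le_three (a := e) (b := e + 1) (c := e + 2)
        omega)
    refine hno I R hR hIR ?_ hind
    rw [hI, Finset.card_pair]
    simpa using n2
  have swap : ∀ R : Finset (ZMod n), Set.InjOn col R → R.card = 8 → ∀ e ∉ R, ∃ f ∈ R,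
      Set.InjOn col (insert e (R.erase f) : Finset (ZMod n)) ∧
      (insert e (R.erase f)).card = 8 := by
    intro R hR h8 e he
    obtain ⟨f, hf, hfe⟩ : ∃ f ∈ R, col f = col e := by
      by_contra! hne
      refine no9 (insert e R) ?_ (by rw [Finset.card_insert_of_notMem he, h8])
      rw [Finset.coe_insert, Set.injOn_insert (by simpa using he)]
      exact ⟨hR, by simpa using hne⟩
    refine ⟨f, hf, ?_, ?_⟩
    · rw [Finset.coe_insert, Set.injOn_insert (by simp [he])]
      refine ⟨hR.mono (by simp), ?_⟩
      rintro ⟨g, hg, hge⟩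
      rw [Finset.mem_coe, Finset.mem_erase] at hg
      exact hg.1 (hR hg.2 hf (hge.trans hfe.symm))
    · rw [Finset.card_insert_of_notMem (by simp [he]), Finset.card_erase_of_mem hf, h8]
  have gap : ∀ R : Finset (ZMod n), Set.InjOn col R → R.card = 8 → ∀ e ∉ R,
      e - 1 ∈ R ∨ e + 1 ∈ R := by
    intro R hR h8 e he
    obtain ⟨f, hf, hR', h8'⟩ := swap R hR h8 e he
    have := single _ hR' h8' e (by simp)
    have p1 : e - 1 ≠ e := by simpa using n1
    have p2 : e + 1 ≠ e := by simpa using n1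
    simp only [Finset.mem_insert, Finset.mem_erase] at this
    tauto
  have pattern : ∀ R : Finset (ZMod n), Set.InjOn col R → R.card = 8 → ∀ i, i ∉ R → i + 1 ∉ R →
      i + 2 ∈ R → i + 3 ∈ R → i + 4 ∉ R → i + 5 ∉ R → False := by
    intro R hR h8 i h0 h1 h2 h3 h4 h5
    obtain ⟨f, hf, hR', h8'⟩ := swap R hR h8 _ h4
    have a1 := single _ hR' h8' (i + 4) (by simp)
    have a2 := gap _ hR' h8' (i + 1)
    have a3 := triple _ hR' h8' (i + 2)
    have e1 : i + 4 - 1 = i + 3 := by ring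
    have e2 : i + 4 + 1 = i + 5 := by ring
    have e3 : i + 1 - 1 = i := by ring
    have e4 : i + 1 + 1 = i + 2 := by ring
    have e5 : i + 2 + 1 = i + 3 := by ring
    have e6 : i + 2 + 2 = i + 4 := by ring
    have e7 : i + 2 - 1 = i + 1 := by ring
    have e8 : i + 2 + 3 = i + 5 := by ring
    rw [e1, e2] at a1
    rw [e3, e4] at a2
    rw [e5, e6, e7, e8] at a3
    have d0 : i ≠ i + 4 := by simpa using n4
    have d1 : i + 1 ≠ i + 4 := fun h => n3 (by linear_combination -h)
    have d2 : i + 2 ≠ i + 4 := fun h => n2 (by linear_combination -h)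
    have d3 : i + 3 ≠ i + 4 := fun h => n1 (by linear_combination -h)
    have d5 : i + 5 ≠ i + 4 := fun h => n1 (by linear_combination h)
    simp only [Finset.mem_insert, Finset.mem_erase, h0, h1, h2, h3, h5, d0, d1, d2, d3, d5,
      and_true, and_false, or_false, false_or, true_or, not_false_eq_true, forall_const] at a1 a2 a3
    by_cases f2 : i + 2 = f
    · exact (a2 f2)
    · exact a3 f2 a1
  obtain ⟨R, hR, h8⟩ : ∃ R : Finset (ZMod n), Set.InjOn col R ∧ R.card = 8 := by
    obtain ⟨S, hS, hS8⟩ := Finset.exists_subset_card_eq hcol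
    obtain ⟨R, -, hR, hRS⟩ := Finset.exists_subset_injOn_image_eq_of_surjOn (f := col) Set.univ S
      (fun x hx => by simpa using hS hx)
    exact ⟨R, hR, by rw [← Finset.card_image_of_injOn hR, hRS, hS8]⟩
  have cS := ZMod.card_filter_add_one (n := n) fun i => i ∈ R ∧ i - 1 ∉ R
  have cA := ZMod.card_filter_add_one (n := n) fun i => i ∈ R ∧ i - 1 ∈ R
  have cG := ZMod.card_filter_add_one (n := n) fun i => i ∉ R ∧ i - 1 ∈ R
  simp only [add_sub_cancel_right] at cS cA cG
  set S := Finset.univ.filter fun i => i ∈ R ∧ i - 1 ∉ R with hSdef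
  set E := Finset.univ.filter fun i => i ∈ R ∧ i + 1 ∉ R with hEdef
  set GS := Finset.univ.filter fun i => i ∉ R ∧ i - 1 ∈ R with hGSdef
  set GE := Finset.univ.filter fun i => i ∉ R ∧ i + 1 ∈ R with hGEdef
  have cE : E.card = GS.card := by
    rw [← cG]
    congr 1
    ext i
    simp [hEdef, and_comm]
  have cS' : GE.card = S.card := by
    rw [← cS]
    congr 1
    ext i
    simp [hGEdef, and_comm]
  have sumS : S.card + (Finset.univ.filter fun i => i ∈ R ∧ i - 1 ∈ R).card = 8 := by
    rw [← h8, ← Finset.card_filter_add_card_filter_not (s := R) (fun i => i - 1 ∉ R)]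
    congr 2 <;> ext i <;> simp [hSdef]
  have sumE : E.card + (Finset.univ.filter fun i => i + 1 ∈ R ∧ i ∈ R).card = 8 := by
    rw [← h8, ← Finset.card_filter_add_card_filter_not (s := R) (fun i => i + 1 ∉ R)]
    congr 2 <;> ext i <;> simp [hEdef, and_comm]
  have unionR : (S ∪ E).card = S.card + E.card := by
    refine Finset.card_union_of_disjoint (Finset.disjoint_left.2 fun i hi hi' => ?_)
    simp only [hSdef, hEdef, Finset.mem_filter, Finset.mem_univ, true_and] at hi hi'
    exact (single R hR h8 i hi.1).elim hi.2 hi'.2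
  have subR : S ∪ E ⊆ R := by
    intro i hi
    simp only [hSdef, hEdef, Finset.mem_union, Finset.mem_filter, Finset.mem_univ, true_and] at hi
    tauto
  have subG : GS ∪ GE = Rᶜ := by
    ext i
    have := gap R hR h8 i
    simp only [hGSdef, hGEdef, Finset.mem_union, Finset.mem_filter, Finset.mem_univ, true_and,
      Finset.mem_compl]
    tauto
  have cR := Finset.card_le_card subR
  have cU := Finset.card_union_add_card_inter GS GE
  have cC := Finset.card_compl R
  rw [ZMod.card] at cC
  rw [subG] at cU
  have eqR : S ∪ E = R := Finset.eq_of_subset_of_card_le subR (by omega)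
  have short : ∀ i ∈ R, i - 1 ∈ R → i + 1 ∉ R := by
    intro i hi
    have : i ∈ S ∪ E := eqR.symm ▸ hi
    simp only [hSdef, hEdef, Finset.mem_union, Finset.mem_filter, Finset.mem_univ, true_and] at this
    tauto
  have both : ∀ i j, i ∉ R → i - 1 ∈ R → i + 1 ∈ R → j ∉ R → j - 1 ∈ R → j + 1 ∈ R → i = j := by
    intro i j hi hi1 hi2 hj hj1 hj2
    have hle : (GS ∩ GE).card ≤ 1 := by omega
    refine Finset.card_le_one.1 hle i ?_ j ?_ <;>
      simp [hGSdef, hGEdef, *]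
  have step : ∀ i, i ∉ R → i + 1 ∉ R →
      i + 3 ∈ R ∧ i + 4 ∉ R ∧ i + 5 ∈ R ∧ i + 6 ∈ R ∧ i + 7 ∉ R := by
    intro i h0 h1
    have b1 := gap R hR h8 (i + 1) h1
    rw [show i + 1 - 1 = i by ring, show i + 1 + 1 = i + 2 by ring] at b1
    have h2 := b1.resolve_left h0
    have b2 := single R hR h8 (i + 2) h2
    rw [show i + 2 - 1 = i + 1 by ring, show i + 2 + 1 = i + 3 by ring] at b2
    have h3 := b2.resolve_left h1
    have h4 := short (i + 3) h3 (by rwa [show i + 3 - 1 = i + 2 by ring])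
    rw [show i + 3 + 1 = i + 4 by ring] at h4
    have h5 : i + 5 ∈ R := by
      by_contra h5
      exact pattern R hR h8 i h0 h1 h2 h3 h4 h5
    have b5 := single R hR h8 (i + 5) h5
    rw [show i + 5 - 1 = i + 4 by ring, show i + 5 + 1 = i + 6 by ring] at b5
    have h6 := b5.resolve_left h4
    have h7 := short (i + 6) h6 (by rwa [show i + 6 - 1 = i + 5 by ring])
    rw [show i + 6 + 1 = i + 7 by ring] at h7
    exact ⟨h3, h4, h5, h6, h7⟩
  obtain ⟨i, hi, hi1⟩ : ∃ i, i ∉ R ∧ i + 1 ∉ R := by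
    by_contra! hall
    have : GS ⊆ GS ∩ GE := by
      intro i hi
      simp only [hGSdef, hGEdef, Finset.mem_inter, Finset.mem_filter, Finset.mem_univ,
        true_and] at hi ⊢
      exact ⟨hi, hi.1, hall i hi.1⟩
    have := Finset.card_le_card this
    omega
  obtain ⟨h3, h4, h5, h6, h7⟩ := step i hi hi1
  have h8' : i + 7 + 1 ∉ R := by
    intro h
    have := both (i + 4) (i + 7) h4 (by rwa [show i + 4 - 1 = i + 3 by ring])
      (by rwa [show i + 4 + 1 = i + 5 by ring]) h7 (by rwa [show i + 7 - 1 = i + 6 by ring]) h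
    exact n3 (by linear_combination -this)
  obtain ⟨k3, k4, k5, -, -⟩ := step (i + 7) h7 h8'
  have := both (i + 4) (i + 7 + 4) h4 (by rwa [show i + 4 - 1 = i + 3 by ring])
    (by rwa [show i + 4 + 1 = i + 5 by ring]) k4
    (by rwa [show i + 7 + 4 - 1 = i + 7 + 3 by ring])
    (by rwa [show i + 7 + 4 + 1 = i + 7 + 5 by ring])
  exact n7 (by linear_combination -this)

/-- Pairwise noncrossing chords of a convex polygon with vertices `i, …, i + m` number at most
`m - 1`, the side `(i, i + m)` being counted as a chord. -/
theorem card_noncrossing_chords_le {E : Finset (ℕ × ℕ)}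
    (hE : ∀ p ∈ E, ∀ q ∈ E, ¬(p.1 < q.1 ∧ q.1 < p.2 ∧ p.2 < q.2)) (hE2 : ∀ p ∈ E, p.1 + 2 ≤ p.2)
    (m i : ℕ) : (E.filter fun p => i ≤ p.1 ∧ p.2 ≤ i + m).card ≤ m - 1 := by
  induction m using Nat.strong_induction_on generalizing i with
  | _ m ih =>
  rcases Nat.lt_or_ge m 2 with hm | hm
  · rw [Finset.filter_false_of_mem]
    · simp
    · intro p hp
      have := hE2 p hp
      omega
  obtain ⟨k, hik, hkm, hk⟩ : ∃ k, i < k ∧ k < i + m ∧ ∀ p ∈ E, i ≤ p.1 → p.2 ≤ i + m →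
      p = (i, i + m) ∨ p.2 ≤ k ∨ k ≤ p.1 := by
    by_cases hne : ∃ p ∈ E, p.1 = i ∧ p.2 < i + m
    · obtain ⟨p, hp, hmax⟩ := Finset.exists_max_image (E.filter fun p => p.1 = i ∧ p.2 < i + m)
        Prod.snd (by simpa [Finset.Nonempty] using hne)
      simp only [Finset.mem_filter] at hp hmax
      have hp2 := hE2 p hp.1
      refine ⟨p.2, by omega, hp.2.2, fun q hq h1 h2 => ?_⟩
      by_contra! hcon
      have hcross := hE p hp.1 q hq
      have hqi : q.1 = i := by omega
      have hqm : q.2 = i + m := by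
        by_contra hlt
        have := hmax q ⟨hq, hqi, by omega⟩
        omega
      exact hcon.1 (Prod.ext hqi hqm)
    · push Not at hne
      refine ⟨i + 1, by omega, by omega, fun q hq h1 h2 => ?_⟩
      by_cases hqi : q.1 = i
      · exact Or.inl (Prod.ext hqi (le_antisymm h2 (hne q hq hqi)))
      · exact Or.inr (Or.inr (by omega))
  have hsub : (E.filter fun p => i ≤ p.1 ∧ p.2 ≤ i + m) ⊆ insert (i, i + m)
      ((E.filter fun p => i ≤ p.1 ∧ p.2 ≤ i + (k - i)) ∪
        E.filter fun p => k ≤ p.1 ∧ p.2 ≤ k + (i + m - k)) := by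
    intro p hp
    simp only [Finset.mem_filter, Finset.mem_insert, Finset.mem_union] at hp ⊢
    rcases hk p hp.1 hp.2.1 hp.2.2 with h | h | h
    · exact Or.inl h
    · exact Or.inr (Or.inl ⟨hp.1, by omega, by omega⟩)
    · exact Or.inr (Or.inr ⟨hp.1, by omega, by omega⟩)
  have h1 := Finset.card_le_card hsub
  have h2 := Finset.card_insert_le (i, i + m) ((E.filter fun p => i ≤ p.1 ∧ p.2 ≤ i + (k - i)) ∪
        E.filter fun p => k ≤ p.1 ∧ p.2 ≤ k + (i + m - k))
  have h3 := Finset.card_union_le (E.filter fun p => i ≤ p.1 ∧ p.2 ≤ i + (k - i))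
        (E.filter fun p => k ≤ p.1 ∧ p.2 ≤ k + (i + m - k))
  have h4 := ih (k - i) (by omega) i
  have h5 := ih (i + m - k) (by omega) k
  omega

/-- The number of noncrossing chords of an `n`-gon, without its sides. -/
theorem card_noncrossing_diagonals_le {E : Finset (ℕ × ℕ)} {n : ℕ}
    (hE : ∀ p ∈ E, ∀ q ∈ E, ¬(p.1 < q.1 ∧ q.1 < p.2 ∧ p.2 < q.2)) (hE2 : ∀ p ∈ E, p.1 + 2 ≤ p.2)
    (hn : 3 ≤ n) (hEn : ∀ p ∈ E, p.2 < n) : (E.erase (0, n - 1)).card ≤ n - 3 := by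
  have h := card_noncrossing_chords_le (E := insert (0, n - 1) E) (by
    intro p hp q hq
    rcases Finset.mem_insert.1 hp with rfl | hp <;> rcases Finset.mem_insert.1 hq with rfl | hq
    · simp
    · have := hEn q hq
      simp only
      omega
    · simp
    · exact hE p hp q hq) (by
    intro p hp
    rcases Finset.mem_insert.1 hp with rfl | hp
    · simp only
      omega
    · exact hE2 p hp) (n - 1) 0
  rw [Finset.filter_true_of_mem] at h
  · rw [← Finset.erase_insert_eq_erase, Finset.card_erase_of_mem (Finset.mem_insert_self _ _)]
    omega
  · intro p hp
    rcases Finset.mem_insert.1 hp with rfl | hp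
    · simp
    · have := hEn p hp
      omega

theorem MaximalOuterplanar.adj_of_noncrossingOn {V : Type*} {G : SimpleGraph V}
    (hG : MaximalOuterplanar G) {r : V → ℤ} (hr : NoncrossingOn G Set.univ r) {u v : V}
    (huv : r u < r v) (h : (∀ x, ¬(r u < r x ∧ r x < r v)) ∨ ∀ x, r u ≤ r x ∧ r x ≤ r v) :
    G.Adj u v := by
  by_contra hadj
  refine hG.2 u v (fun h => by simp [h] at huv) hadj
    (NoncrossingOn.outerplanar (r := r) ⟨hr.1, fun a b c d _ _ _ _ hab hbc hcd hac hbd => ?_⟩)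
  simp only [sup_adj, fromEdgeSet_adj, Set.mem_singleton_iff, Sym2.eq_iff] at hac hbd
  rcases hac with hac | ⟨⟨rfl, rfl⟩ | ⟨rfl, rfl⟩, -⟩ <;>
    rcases hbd with hbd | ⟨⟨rfl, rfl⟩ | ⟨rfl, rfl⟩, -⟩
  · exact hr.2 trivial trivial trivial trivial hab hbc hcd hac hbd
  · exact h.elim (fun h => h _ ⟨hbc, hcd⟩) fun h => by have := h a; omega
  all_goals try omega
  · exact h.elim (fun h => h _ ⟨hab, hbc⟩) fun h => by have := h d; omega

/-- A maximal outerplanar graph is a polygon triangulated by noncrossing diagonals. -/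
theorem MaximalOuterplanar.exists_order {n : ℕ} {G : SimpleGraph (Fin n)} (hn : 2 ≤ n)
    (hG : MaximalOuterplanar G) : ∃ w : ℕ → Fin n, Set.InjOn w (Set.Iio n) ∧
      (∀ x, ∃ k < n, w k = x) ∧ (∀ k, k + 1 < n → G.Adj (w k) (w (k + 1))) ∧
      G.Adj (w 0) (w (n - 1)) ∧
      ∀ a b c d, a < b → b < c → c < d → d < n → G.Adj (w a) (w c) → ¬G.Adj (w b) (w d) := by
  obtain ⟨r, hr⟩ := hG.1.exists_noncrossingOn Finset.univ
  rw [Finset.coe_univ] at hr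
  have hmono : StrictMono (r ∘ Tuple.sort r) := (Tuple.monotone_sort r).strictMono_of_injective
    ((Set.injOn_univ.1 hr.1).comp (Tuple.sort r).injective)
  have : NeZero n := ⟨by omega⟩
  have hw : ∀ k, (hk : k < n) → Fin.ofNat n k = ⟨k, hk⟩ := fun k hk =>
    Fin.ext (Nat.mod_eq_of_lt hk)
  have hlt : ∀ a b, a < b → b < n →
      r (Tuple.sort r (Fin.ofNat n a)) < r (Tuple.sort r (Fin.ofNat n b)) := by
    intro a b hab hb
    rw [hw a (by omega), hw b hb]
    exact hmono hab
  have hle : ∀ x y, (x : Fin n) ≤ y → r (Tuple.sort r x) ≤ r (Tuple.sort r y) := fun x y h =>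
    hmono.monotone h
  refine ⟨fun k => Tuple.sort r (Fin.ofNat n k), ?_, ?_, ?_, ?_, ?_⟩
  · intro a ha b hb hab
    have := (Tuple.sort r).injective hab
    rw [hw a ha, hw b hb] at this
    exact congrArg Fin.val this
  · intro x
    obtain ⟨y, rfl⟩ := (Tuple.sort r).surjective x
    exact ⟨y, y.2, by simp only [hw y y.2]⟩
  · intro k hk
    refine hG.adj_of_noncrossingOn hr (hlt _ _ (by omega) hk) (Or.inl fun x => ?_)
    obtain ⟨y, rfl⟩ := (Tuple.sort r).surjective x
    simp only [hw k (by omega), hw _ hk]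
    rintro ⟨h1, h2⟩
    have h1 := hmono.lt_iff_lt.1 h1
    have h2 := hmono.lt_iff_lt.1 h2
    rw [Fin.lt_def] at h1 h2
    simp only at h1 h2
    omega
  · refine hG.adj_of_noncrossingOn hr (hlt _ _ (by omega) (by omega)) (Or.inr fun x => ?_)
    obtain ⟨y, rfl⟩ := (Tuple.sort r).surjective x
    simp only [hw 0 (by omega), hw (n - 1) (by omega)]
    refine ⟨hle _ _ (Fin.le_def.2 (Nat.zero_le _)), hle _ _ (Fin.le_def.2 ?_)⟩
    have := y.2
    simp only
    omega
  · intro a b c d hab hbc hcd hd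
    exact hr.2 trivial trivial trivial trivial (hlt _ _ hab (by omega)) (hlt _ _ hbc (by omega))
      (hlt _ _ hcd hd)

/-- An edge colouring of a maximal outerplanar graph with at least `n + 5` colours uses at least
eight of them on the Hamiltonian cycle, hence has a rainbow matching of size five. -/
theorem MaximalOuterplanar.exists_isRainbowMatching {n : ℕ} {G : SimpleGraph (Fin n)}
    (hn : 15 ≤ n) (hG : MaximalOuterplanar G) (c : Sym2 (Fin n) → ℕ)
    (hc : n + 5 ≤ (c '' G.edgeSet).ncard) : ∃ M, IsRainbowMatching G c 5 M := by
  classical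
  obtain ⟨w, hinj, hsurj, hpath, hclose, hcross⟩ := hG.exists_order (by omega)
  have : NeZero n := ⟨by omega⟩
  have : Fact (1 < n) := ⟨by omega⟩
  set v : ZMod n → Fin n := fun i => w i.val with hv
  have vinj : Function.Injective v := fun i j h =>
    ZMod.val_injective n (hinj (ZMod.val_lt i) (ZMod.val_lt j) h)
  have vcast : ∀ k < n, v k = w k := fun k hk => by simp only [hv, ZMod.val_natCast_of_lt hk]
  have vlast : v ((n - 1 : ℕ) + 1) = w 0 := by
    rw [← Nat.cast_add_one, Nat.sub_add_cancel (by omega), ZMod.natCast_self]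
    simp only [hv, ZMod.val_zero]
  have vadj : ∀ i, G.Adj (v i) (v (i + 1)) := by
    intro i
    obtain ⟨k, hk, rfl⟩ : ∃ k < n, (k : ZMod n) = i := ⟨i.val, ZMod.val_lt i, by simp⟩
    rcases Nat.lt_or_ge (k + 1) n with h | h
    · rw [← Nat.cast_add_one, vcast k hk, vcast _ h]
      exact hpath k h
    · obtain rfl : k = n - 1 := by omega
      rw [vlast, vcast _ hk]
      exact hclose.symm
  set col : ZMod n → ℕ := fun i => c s(v i, v (i + 1)) with hcol
  set E := ((Finset.range n ×ˢ Finset.range n).filter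
    fun p => G.Adj (w p.1) (w p.2) ∧ p.1 + 2 ≤ p.2) with hE
  have memE : ∀ p, p ∈ E ↔ (p.1 < n ∧ p.2 < n) ∧ G.Adj (w p.1) (w p.2) ∧ p.1 + 2 ≤ p.2 := by
    simp [hE]
  have hdiag : (E.erase (0, n - 1)).card ≤ n - 3 := card_noncrossing_diagonals_le
    (fun p hp q hq ⟨h1, h2, h3⟩ => hcross _ _ _ _ h1 h2 h3 ((memE q).1 hq).1.2
      ((memE p).1 hp).2.1 ((memE q).1 hq).2.1)
    (fun p hp => ((memE p).1 hp).2.2) (by omega) (fun p hp => ((memE p).1 hp).1.2)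
  have hcover : c '' G.edgeSet ⊆ (Finset.univ.image col ∪
      (E.erase (0, n - 1)).image fun p => c s(w p.1, w p.2) : Finset ℕ) := by
    rintro _ ⟨e, he, rfl⟩
    obtain ⟨a, b, hab, hb, rfl⟩ : ∃ a b, a < b ∧ b < n ∧ e = s(w a, w b) := by
      induction e with
      | _ x y =>
      obtain ⟨a, ha, rfl⟩ := hsurj x
      obtain ⟨b, hb, rfl⟩ := hsurj y
      rcases lt_trichotomy a b with h | rfl | h
      · exact ⟨a, b, h, hb, rfl⟩
      · exact (G.loopless.irrefl _ he).elim
      · exact ⟨b, a, h, ha, Sym2.eq_swap⟩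
    simp only [Finset.coe_union, Finset.coe_image, Set.mem_union, Set.mem_image, Finset.mem_coe,
      Finset.mem_univ, true_and, Finset.mem_erase, memE]
    by_cases h1 : b = a + 1
    · refine Or.inl ⟨a, ?_⟩
      rw [hcol, h1, ← vcast a (by omega), ← vcast (a + 1) (by omega), Nat.cast_add_one]
    by_cases h2 : (a, b) = (0, n - 1)
    · obtain ⟨rfl, rfl⟩ := Prod.mk.inj h2
      refine Or.inl ⟨(n - 1 : ℕ), ?_⟩
      simp only [hcol]
      rw [vlast, vcast _ hb, Sym2.eq_swap]
    · exact Or.inr ⟨(a, b), ⟨h2, ⟨by omega, hb⟩, he, by omega⟩, rfl⟩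
  have h8 : 8 ≤ (Finset.univ.image col).card := by
    have h1 := Set.ncard_le_ncard hcover (Finset.finite_toSet _)
    rw [Set.ncard_coe_finset] at h1
    have h2 := Finset.card_union_le (Finset.univ.image col)
      ((E.erase (0, n - 1)).image fun p => c s(w p.1, w p.2))
    have h3 : ((E.erase (0, n - 1)).image fun p => c s(w p.1, w p.2)).card ≤ _ :=
      Finset.card_image_le
    omega
  obtain ⟨I, hI, hIcol, hind⟩ := ZMod.exists_rainbow_independent hn col h8
  refine ⟨I.image fun i => s(v i, v (i + 1)), ⟨?_, ?_⟩, ?_, ?_⟩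
  · intro e he
    obtain ⟨i, -, rfl⟩ := Finset.mem_image.1 he
    exact vadj i
  · intro e he f hf hef x hxe hxf
    obtain ⟨i, hi, rfl⟩ := Finset.mem_image.1 he
    obtain ⟨j, hj, rfl⟩ := Finset.mem_image.1 hf
    have hij : i ≠ j := fun h => hef (by rw [h])
    rcases Sym2.mem_iff.1 hxe with rfl | rfl <;> rcases Sym2.mem_iff.1 hxf with h | h <;>
      have h := vinj h
    · exact hij h
    · exact hind j hj (h ▸ hi)
    · exact hind i hi (h ▸ hj)
    · exact hij (add_right_cancel h)
  · rw [Finset.card_image_of_injOn fun i hi j hj h => hIcol hi hj (congrArg c h), hI]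
  · rw [Finset.coe_image]
    rintro _ ⟨i, hi, rfl⟩ _ ⟨j, hj, rfl⟩ h
    rw [hIcol hi hj h]

/-- The fan: a path `1, …, n - 1` together with the vertex `0` joined to all others. -/
def fanGraph (n : ℕ) : SimpleGraph (Fin n) where
  Adj u v := u ≠ v ∧ (u.val = 0 ∨ v.val = 0 ∨ u.val + 1 = v.val ∨ v.val + 1 = u.val)
  symm := ⟨fun _ _ h => ⟨h.1.symm, by tauto⟩⟩
  loopless := ⟨fun _ h => h.1 rfl⟩

theorem fanGraph_adj {n : ℕ} {u v : Fin n} : (fanGraph n).Adj u v ↔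
    u ≠ v ∧ (u.val = 0 ∨ v.val = 0 ∨ u.val + 1 = v.val ∨ v.val + 1 = u.val) := Iff.rfl

theorem fanGraph_adj_of_lt {n : ℕ} {u v : Fin n} (h : u < v) :
    (fanGraph n).Adj u v ↔ u.val = 0 ∨ u.val + 1 = v.val := by
  rw [fanGraph_adj, Ne, Fin.ext_iff]
  rw [Fin.lt_def] at h
  omega

theorem outerplanar_fanGraph (n : ℕ) : Outerplanar (fanGraph n) := by
  refine NoncrossingOn.outerplanar (r := fun x => (x.val : ℤ))
    ⟨fun x _ y _ h => Fin.ext (by simpa using h), fun a b c d _ _ _ _ hab hbc hcd hac hbd => ?_⟩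
  simp only [fanGraph_adj] at hac hbd hab hbc hcd
  omega

theorem connected_induce_interval {n : ℕ} {G : SimpleGraph (Fin n)}
    (hG : ∀ x y : Fin n, x.val + 1 = y.val → G.Adj x y) {a b : ℕ} (hab : a < b) (hb : b ≤ n) :
    (G.induce {x | a ≤ x.val ∧ x.val < b}).Connected := by
  induction b, hab using Nat.le_induction with
  | base =>
    have : {x : Fin n | a ≤ x.val ∧ x.val < a.succ} = {⟨a, hb⟩} := by
      ext x
      simp [Fin.ext_iff]
      omega
    rw [this]
    exact connected_induce_singleton G _
  | succ b hab ih =>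
    have : {x : Fin n | a ≤ x.val ∧ x.val < b + 1} =
        {x | a ≤ x.val ∧ x.val < b} ∪ {⟨b, hb⟩} := by
      ext x
      simp [Fin.ext_iff]
      omega
    rw [this]
    refine induce_union_connected_of_adj (ih (by omega)) (connected_induce_singleton G _)
      ⟨⟨b - 1, by omega⟩, ⟨?_, ?_⟩, _, rfl, hG _ _ ?_⟩ <;> simp only <;> omega

theorem maximalOuterplanar_fanGraph (n : ℕ) : MaximalOuterplanar (fanGraph n) := by
  refine ⟨outerplanar_fanGraph n, ?_⟩
  suffices h : ∀ u v : Fin n, u < v → ¬(fanGraph n).Adj u v →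
      ¬Outerplanar (fanGraph n ⊔ fromEdgeSet {s(u, v)}) by
    intro u v huv hadj
    rcases huv.lt_or_gt with hlt | hlt
    · exact h u v hlt hadj
    · rw [Sym2.eq_swap]
      exact h v u hlt fun h' => hadj h'.symm
  intro u v huv hadj
  rw [fanGraph_adj_of_lt huv] at hadj
  rw [Fin.lt_def] at huv
  have hv := v.2
  set G := fanGraph n ⊔ fromEdgeSet {s(u, v)} with hG
  have hpath : ∀ x y : Fin n, x.val + 1 = y.val → G.Adj x y := fun x y h =>
    Or.inl ⟨fun h' => by simp [h'] at h, Or.inr (Or.inr (Or.inl h))⟩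
  have huv' : G.Adj u v := by
    refine Or.inr ?_
    rw [fromEdgeSet_adj]
    exact ⟨rfl, fun h => by simp [h] at huv⟩
  have hzero : ∀ x y : Fin n, x.val = 0 → 0 < y.val → G.Adj x y := fun x y h h' =>
    Or.inl ⟨fun h'' => by rw [← h''] at h'; omega, Or.inl h⟩
  let lo : Fin 4 → ℕ := ![0, u.val, u.val + 1, v.val]
  let hi : Fin 4 → ℕ := ![u.val, u.val + 1, v.val, n]
  have hlohi : ∀ i, lo i < hi i ∧ hi i ≤ n := by
    intro i
    fin_cases i <;> simp [lo, hi] <;> omega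
  have hsep : ∀ i j, i < j → hi i ≤ lo j := by
    intro i j hij
    fin_cases i <;> fin_cases j <;> simp [lo, hi] at hij ⊢ <;> omega
  have hadj' : ∀ i j, i < j → ∃ x, (lo i ≤ x.val ∧ x.val < hi i) ∧
      ∃ y : Fin n, (lo j ≤ y.val ∧ y.val < hi j) ∧ G.Adj x y := by
    intro i j hij
    by_cases hi0 : i = 0
    · subst hi0
      have h1 := hlohi j
      have h2 := hsep 0 j hij
      have h3 := hlohi 0
      exact ⟨⟨0, by omega⟩, ⟨le_rfl, h3.1⟩, ⟨lo j, by omega⟩, ⟨le_rfl, h1.1⟩,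
        hzero _ _ rfl (by simp only; omega)⟩
    · have : (i = 1 ∧ j = 2) ∨ (i = 1 ∧ j = 3) ∨ (i = 2 ∧ j = 3) := by omega
      rcases this with ⟨rfl, rfl⟩ | ⟨rfl, rfl⟩ | ⟨rfl, rfl⟩
      · exact ⟨u, by simp [lo, hi], ⟨u.val + 1, by omega⟩, by simp [lo, hi]; omega, hpath _ _ rfl⟩
      · exact ⟨u, by simp [lo, hi], v, by simp [lo, hi], huv'⟩
      · exact ⟨⟨v.val - 1, by omega⟩, by simp [lo, hi]; omega, v, by simp [lo, hi],
          hpath _ _ (by simp only; omega)⟩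
  refine fun hout => hout.1 ⟨fun i => {x | lo i ≤ x.val ∧ x.val < hi i}, ?_, ?_, ?_, ?_⟩
  · intro i
    have := hlohi i
    exact ⟨⟨lo i, by omega⟩, le_rfl, this.1⟩
  · intro i
    exact connected_induce_interval hpath (hlohi i).1 (hlohi i).2
  · intro i j hij
    refine Set.disjoint_left.2 fun x hx hx' => ?_
    simp only [Set.mem_ofPred_eq] at hx hx'
    rcases hij.lt_or_gt with h | h <;> have := hsep _ _ h <;> omega
  · intro i j hij
    rcases (show i ≠ j from hij.ne).lt_or_gt with h | h
    · exact hadj' i j h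
    · obtain ⟨x, hx, y, hy, hxy⟩ := hadj' j i h
      exact ⟨y, hy, x, hx, hxy.symm⟩

/-- The colouring of the fan giving distinct colours to the edges at `0` and to the edges
`12`, `23`, `34`, `45`, and the same colour `0` to all others. -/
def fanColoring (n : ℕ) (e : Sym2 (Fin n)) : ℕ :=
  if e.inf.val = 0 then e.sup.val else if e.sup.val ≤ 5 then n + e.sup.val else 0

theorem fanColoring_of_lt {n : ℕ} {x y : Fin n} (h : x < y) : fanColoring n s(x, y) =
    if x.val = 0 then y.val else if y.val ≤ 5 then n + y.val else 0 := by
  simp only [fanColoring, Sym2.inf_mk, Sym2.sup_mk, inf_eq_left.2 h.le, sup_eq_right.2 h.le]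

theorem exists_lt_of_mem_edgeSet {n : ℕ} {G : SimpleGraph (Fin n)} {e : Sym2 (Fin n)}
    (he : e ∈ G.edgeSet) : ∃ x y, x < y ∧ G.Adj x y ∧ e = s(x, y) := by
  induction e with
  | _ x y =>
  rcases lt_trichotomy x y with h | rfl | h
  · exact ⟨x, y, h, he, rfl⟩
  · exact (G.loopless.irrefl _ he).elim
  · exact ⟨y, x, h, he.symm, Sym2.eq_swap⟩

theorem ncard_fanColoring {n : ℕ} (hn : 7 ≤ n) :
    (fanColoring n '' (fanGraph n).edgeSet).ncard = n + 4 := by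
  have : fanColoring n '' (fanGraph n).edgeSet =
      (Finset.range n ∪ Finset.Icc (n + 2) (n + 5) : Finset ℕ) := by
    ext k
    simp only [Set.mem_image, Finset.coe_union, Set.mem_union, Finset.mem_coe, Finset.mem_range,
      Finset.mem_Icc]
    constructor
    · rintro ⟨e, he, rfl⟩
      obtain ⟨x, y, hxy, hadj, rfl⟩ := exists_lt_of_mem_edgeSet he
      rw [fanColoring_of_lt hxy]
      rw [Fin.lt_def] at hxy
      have := y.2
      split_ifs <;> omega
    · have key : ∀ a b, (ha : a < b) → (hb : b < n) → (a = 0 ∨ a + 1 = b) →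
          (if a = 0 then b else if b ≤ 5 then n + b else 0) = k →
          ∃ e ∈ (fanGraph n).edgeSet, fanColoring n e = k := by
        intro a b ha hb hab h
        have hlt : (⟨a, ha.trans hb⟩ : Fin n) < ⟨b, hb⟩ := ha
        exact ⟨s(⟨a, ha.trans hb⟩, ⟨b, hb⟩), (fanGraph_adj_of_lt hlt).2 hab,
          (fanColoring_of_lt hlt).trans h⟩
      intro hk
      by_cases hk0 : k = 0
      · exact key 5 6 (by omega) (by omega) (by omega) (by simp [hk0])
      by_cases hkn : k < n
      · exact key 0 k (by omega) hkn (by omega) (by simp)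
      · refine key (k - n - 1) (k - n) (by omega) (by omega) (by omega) ?_
        rw [if_neg (by omega), if_pos (by omega)]
        omega
  rw [this, Set.ncard_coe_finset, Finset.card_union_of_disjoint]
  · simp
  · refine Finset.disjoint_left.2 fun k hk hk' => ?_
    simp only [Finset.mem_range, Finset.mem_Icc] at hk hk'
    omega

theorem not_exists_isRainbowMatching_fanColoring (n : ℕ) :
    ¬∃ M, IsRainbowMatching (fanGraph n) (fanColoring n) 5 M := by
  rintro ⟨M, ⟨hMG, hM⟩, hcard, hinj⟩
  let φ : Sym2 (Fin n) → ℕ := fun e =>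
    if e.inf.val = 0 then 0 else if e.sup.val ≤ 5 then e.sup.val / 2 else 3
  have hφ : ∀ x y : Fin n, x < y →
      φ s(x, y) = if x.val = 0 then 0 else if y.val ≤ 5 then y.val / 2 else 3 := by
    intro x y h
    simp only [φ, Sym2.inf_mk, Sym2.sup_mk, inf_eq_left.2 h.le, sup_eq_right.2 h.le]
  obtain ⟨e, he, f, hf, hne, hef⟩ := Finset.exists_ne_map_eq_of_card_lt_of_maps_to
    (s := M) (t := Finset.range 4) (f := φ) (by simp [hcard]) (fun e _ => by
      simp only [φ, Finset.coe_range, Set.mem_Iio]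
      split_ifs <;> omega)
  obtain ⟨x, y, hxy, hadj, rfl⟩ := exists_lt_of_mem_edgeSet (hMG e he)
  obtain ⟨z, t, hzt, hadj', rfl⟩ := exists_lt_of_mem_edgeSet (hMG f hf)
  rw [hφ _ _ hxy, hφ _ _ hzt] at hef
  rw [fanGraph_adj_of_lt hxy] at hadj
  rw [fanGraph_adj_of_lt hzt] at hadj'
  have hcol : fanColoring n s(x, y) ≠ fanColoring n s(z, t) := fun h => hne (hinj he hf h)
  rw [fanColoring_of_lt hxy, fanColoring_of_lt hzt] at hcol
  have hx := hM _ he _ hf hne x (Sym2.mem_mk_left x y)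
  have hy := hM _ he _ hf hne y (Sym2.mem_mk_right x y)
  rw [Sym2.mem_iff, Fin.ext_iff, Fin.ext_iff] at hx hy
  rw [Fin.lt_def] at hxy hzt
  split_ifs at hef hcol <;> omega

/-- `ar(𝒪ₙ, M₅) = n + 4` for `n ≥ 15`: every coloring of a maximal outerplanar graph on `n`
vertices with at least `n + 5` colors yields a rainbow `M₅`, and some maximal outerplanar
graph on `n` vertices has an `(n+4)`-coloring with no rainbow `M₅`. -/
theorem stmt6 (n : ℕ) (hn : 15 ≤ n) :
    (∀ G : SimpleGraph (Fin n), MaximalOuterplanar G → ∀ c : Sym2 (Fin n) → ℕ,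
      n + 5 ≤ (c '' G.edgeSet).ncard → ∃ M, IsRainbowMatching G c 5 M) ∧
    (∃ (G : SimpleGraph (Fin n)) (c : Sym2 (Fin n) → ℕ), MaximalOuterplanar G ∧
      (c '' G.edgeSet).ncard = n + 4 ∧ ¬ ∃ M, IsRainbowMatching G c 5 M) :=
  ⟨fun _ hG c hc => hG.exists_isRainbowMatching hn c hc,
    fanGraph n, fanColoring n, maximalOuterplanar_fanGraph n, ncard_fanColoring (by omega),
    not_exists_isRainbowMatching_fanColoring n⟩
end
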